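/- arXiv:math/0407353 — 5 statements merged into one kernel-verified Lean document; each statement's English description precedes it below -/
import Mathlib

section
/- For all integers 1 ≤ k ≤ n, the second moment of the number of increasing subsequences of length k in a uniformly random permutation of {1,…,n} satisfies E[Z_{n,k}²] = (1/n!)·∑_{σ∈S_n} Z_{n,k}(σ)² = ∑_{j=0}^{k} C(n, 2k−j) · A(k−j, j) / (2k−j)!, where C(n,m) = 0 when m > n. -/
/-- `Z n k σ` is the number of increasing subsequences of length `k` of the
permutation `σ` of `{1,…,n}`. -/
def Z (n k : ℕ) (σ : Equiv.Perm (Fin n)) : ℕ :=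
  (((Finset.univ : Finset (Fin n)).powersetCard k).filter
    (fun s => ∀ x ∈ s, ∀ y ∈ s, x < y → σ x < σ y)).card

/-- `A N j = ∑ ∏_{r=0}^{j} C(l_r+m_r, l_r)²`, the sum being over all pairs of
`(j+1)`-tuples of nonnegative integers `(l_0,…,l_j)`, `(m_0,…,m_j)` each summing to `N`. -/
def A (N j : ℕ) : ℕ :=
  ∑ l ∈ Finset.Nat.antidiagonalTuple (j+1) N,
    ∑ m ∈ Finset.Nat.antidiagonalTuple (j+1) N,
      ∏ r : Fin (j+1), ((l r + m r).choose (l r))^2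

namespace IncreasingSubsequences

open Finset

/-! ### Block types of words over `Bool × Bool` -/

/-- The letters `(true, true)` cut a word into blocks; `blockType` lists, for every block, the
numbers of letters `(true, false)` and `(false, true)` it contains (the first block is kept apart
from the list of the other ones). -/
def blockType : List (Bool × Bool) → (ℕ × ℕ) × List (ℕ × ℕ)
  | [] => ((0, 0), [])
  | (false, false) :: w => blockType w
  | (true, false) :: w => (((blockType w).1.1 + 1, (blockType w).1.2), (blockType w).2)
  | (false, true) :: w => (((blockType w).1.1, (blockType w).1.2 + 1), (blockType w).2)
  | (true, true) :: w => ((0, 0), (blockType w).1 :: (blockType w).2)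

/-- The number of letters different from `(false, false)` in a word of the given block type. -/
def weight (τ : (ℕ × ℕ) × List (ℕ × ℕ)) : ℕ :=
  τ.1.1 + τ.1.2 + (τ.2.map fun x => x.1 + x.2 + 1).sum

/-- The number of words without letter `(false, false)` of the given block type. -/
def blockCount (τ : (ℕ × ℕ) × List (ℕ × ℕ)) : ℕ :=
  (τ.1.1 + τ.1.2).choose τ.1.1 * (τ.2.map fun x => (x.1 + x.2).choose x.1).prod

theorem card_blockType_eq_succ (n : ℕ) (τ : (ℕ × ℕ) × List (ℕ × ℕ)) :
    #{w : Fin (n + 1) → Bool × Bool | blockType (List.ofFn w) = τ} =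
      #{w : Fin n → Bool × Bool | blockType ((true, true) :: List.ofFn w) = τ} +
      #{w : Fin n → Bool × Bool | blockType ((true, false) :: List.ofFn w) = τ} +
      (#{w : Fin n → Bool × Bool | blockType ((false, true) :: List.ofFn w) = τ} +
      #{w : Fin n → Bool × Bool | blockType ((false, false) :: List.ofFn w) = τ}) := by
  simp only [card_filter]
  rw [← (Fin.consEquiv fun _ : Fin (n + 1) => Bool × Bool).sum_comp]
  simp only [Fintype.sum_prod_type, Fintype.sum_bool]
  have (c : Bool × Bool) (w : Fin n → Bool × Bool) :
      List.ofFn (Fin.consEquiv (fun _ => Bool × Bool) (c, w)) = c :: List.ofFn w :=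
    List.ofFn_cons c w
  simp only [this]

theorem card_blockType_eq (n : ℕ) (τ : (ℕ × ℕ) × List (ℕ × ℕ)) :
    #{w : Fin n → Bool × Bool | blockType (List.ofFn w) = τ} =
      n.choose (weight τ) * blockCount τ := by
  induction n generalizing τ with
  | zero =>
    obtain ⟨⟨a, b⟩, L⟩ := τ
    rcases a with _ | a <;> rcases b with _ | b <;> rcases L with _ | ⟨x, L⟩ <;>
      simp [blockType, weight, blockCount, ← add_assoc, add_right_comm _ 1]
  | succ n ih =>
    obtain ⟨⟨a, b⟩, L⟩ := τ
    rw [card_blockType_eq_succ]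
    have hS : ∀ a b L, #{w : Fin n → Bool × Bool |
        blockType ((true, false) :: List.ofFn w) = ((a + 1, b), L)} =
        #{w : Fin n → Bool × Bool | blockType (List.ofFn w) = ((a, b), L)} := by
      intro a b L; congr 1; ext w; simp [blockType, Prod.ext_iff]
    have hT : ∀ a b L, #{w : Fin n → Bool × Bool |
        blockType ((false, true) :: List.ofFn w) = ((a, b + 1), L)} =
        #{w : Fin n → Bool × Bool | blockType (List.ofFn w) = ((a, b), L)} := by
      intro a b L; congr 1; ext w; simp [blockType, Prod.ext_iff]
    have hB : ∀ x L, #{w : Fin n → Bool × Bool |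
        blockType ((true, true) :: List.ofFn w) = ((0, 0), x :: L)} =
        #{w : Fin n → Bool × Bool | blockType (List.ofFn w) = (x, L)} := by
      intro a L; congr 1; ext w; simp [blockType, Prod.ext_iff]
    have hS' : ∀ b L, #{w : Fin n → Bool × Bool |
        blockType ((true, false) :: List.ofFn w) = ((0, b), L)} = 0 := by
      intro b L; simp [blockType, Prod.ext_iff]
    have hT' : ∀ a L, #{w : Fin n → Bool × Bool |
        blockType ((false, true) :: List.ofFn w) = ((a, 0), L)} = 0 := by
      intro b L; simp [blockType, Prod.ext_iff]
    have hB' : ∀ a b L, (a ≠ 0 ∨ b ≠ 0 ∨ L = []) → #{w : Fin n → Bool × Bool |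
        blockType ((true, true) :: List.ofFn w) = ((a, b), L)} = 0 := by
      intro a b L h
      rw [card_eq_zero, filter_eq_empty_iff]
      rintro w - h'
      simp only [blockType, Prod.mk.injEq] at h'
      obtain ⟨⟨rfl, rfl⟩, rfl⟩ := h'
      simp at h
    have hN : ∀ τ, #{w : Fin n → Bool × Bool |
        blockType ((false, false) :: List.ofFn w) = τ} = n.choose (weight τ) * blockCount τ := ih
    rcases a with _ | a <;> rcases b with _ | b
    · rcases L with _ | ⟨x, L⟩
      · rw [hB' _ _ _ (by simp), hS', hT', hN]
        simp [weight, blockCount]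
      · rw [hB, hS', hT', hN, ih]
        simp only [weight, blockCount, List.map_cons, List.sum_cons, List.prod_cons, zero_add,
          Nat.choose_self, one_mul, add_right_comm _ 1, Nat.choose_succ_succ]
        ring
    · rw [hB' _ _ _ (by simp), hS', hT, hN, ih]
      simp only [weight, blockCount, ← add_assoc, add_right_comm _ 1, Nat.choose_succ_succ,
        Nat.choose_zero_right]
      ring
    · rw [hB' _ _ _ (by simp), hS, hT', hN, ih]
      simp only [weight, blockCount, ← add_assoc, add_right_comm _ 1, Nat.choose_succ_succ,
        add_zero, Nat.choose_self, Nat.choose_succ_self]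
      ring
    · rw [hB' _ _ _ (by simp), hS, hT, hN, ih, ih]
      have h₁ : weight ((a + 1, b + 1), L) = weight ((a + 1, b), L) + 1 := by
        simp only [weight]; ring
      have h₂ : weight ((a, b + 1), L) = weight ((a + 1, b), L) := by
        simp only [weight]; ring
      have h₃ : blockCount ((a + 1, b + 1), L) =
          blockCount ((a, b + 1), L) + blockCount ((a + 1, b), L) := by
        simp only [blockCount]
        rw [show a + 1 + (b + 1) = a + b + 1 + 1 by ring, Nat.choose_succ_succ,
          show a + (b + 1) = a + b + 1 by ring, show a + 1 + b = a + b + 1 by ring]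
        ring
      rw [h₁, h₂, h₃, Nat.choose_succ_succ]
      ring

theorem sum_toNat_fst (w : List (Bool × Bool)) :
    (w.map fun c => c.1.toNat).sum =
      (blockType w).1.1 + ((blockType w).2.map Prod.fst).sum + (blockType w).2.length := by
  fun_induction blockType w <;> simp_all <;> omega

theorem sum_toNat_snd (w : List (Bool × Bool)) :
    (w.map fun c => c.2.toNat).sum =
      (blockType w).1.2 + ((blockType w).2.map Prod.snd).sum + (blockType w).2.length := by
  fun_induction blockType w <;> simp_all <;> omega

theorem sum_toNat_and (w : List (Bool × Bool)) :
    (w.map fun c => (c.1 && c.2).toNat).sum = (blockType w).2.length := by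
  fun_induction blockType w <;> simp_all
  omega

/-! ### Ranks of the common letters -/

/-- The list of the pairs `(i, j)` such that some letter `(true, true)` of the word is preceded by
exactly `i` letters with first component `true` and `j` letters with second component `true`. -/
def commonRanks : List (Bool × Bool) → List (ℕ × ℕ)
  | [] => []
  | c :: w => (if c.1 && c.2 then [(0, 0)] else []) ++
      (commonRanks w).map (· + (c.1.toNat, c.2.toNat))

/-- The list `commonRanks` expressed through the block type. -/
def cumulate : ℕ × ℕ → List (ℕ × ℕ) → List (ℕ × ℕ)
  | _, [] => []
  | x, y :: L => x :: (cumulate y L).map (· + (x + (1, 1)))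

theorem cumulate_add (x y : ℕ × ℕ) (L : List (ℕ × ℕ)) :
    cumulate (x + y) L = (cumulate x L).map (· + y) := by
  cases L with
  | nil => rfl
  | cons z L =>
    simp only [cumulate, List.map_cons, List.map_map, List.cons.injEq, true_and]
    refine List.map_congr_left fun u _ => ?_
    simp only [Function.comp_apply]
    abel

theorem commonRanks_eq_cumulate (w : List (Bool × Bool)) :
    commonRanks w = cumulate (blockType w).1 (blockType w).2 := by
  fun_induction blockType w with
  | case1 => rfl
  | case2 w ih => simp [commonRanks, ih, ← Prod.zero_eq_mk]
  | case3 w ih =>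
    rw [show ((blockType w).1.1 + 1, (blockType w).1.2) = (blockType w).1 + (1, 0) from rfl,
      cumulate_add, ← ih]
    simp [commonRanks]
  | case4 w ih =>
    rw [show ((blockType w).1.1, (blockType w).1.2 + 1) = (blockType w).1 + (0, 1) from rfl,
      cumulate_add, ← ih]
    simp [commonRanks]
  | case5 w ih => simp [commonRanks, cumulate, ← ih]

theorem cumulate_injective {x x' : ℕ × ℕ} {L L' : List (ℕ × ℕ)}
    (h : cumulate x L = cumulate x' L')
    (h₁ : x.1 + (L.map Prod.fst).sum = x'.1 + (L'.map Prod.fst).sum)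
    (h₂ : x.2 + (L.map Prod.snd).sum = x'.2 + (L'.map Prod.snd).sum) : x = x' ∧ L = L' := by
  induction L generalizing x x' L' with
  | nil =>
    cases L' with
    | nil => exact ⟨Prod.ext (by simpa using h₁) (by simpa using h₂), rfl⟩
    | cons y L' => simp [cumulate] at h
  | cons y L ih =>
    cases L' with
    | nil => simp [cumulate] at h
    | cons y' L' =>
      simp only [cumulate, List.cons.injEq] at h
      obtain ⟨rfl, h⟩ := h
      have h := List.map_injective_iff.2 (add_left_injective (x + (1, 1))) h
      obtain ⟨rfl, rfl⟩ := ih h (by simpa using h₁) (by simpa using h₂)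
      exact ⟨rfl, rfl⟩

theorem length_cumulate (x : ℕ × ℕ) (L : List (ℕ × ℕ)) : (cumulate x L).length = L.length := by
  induction L generalizing x with
  | nil => rfl
  | cons y L ih => simp [cumulate, ih]

theorem pairwise_commonRanks (w : List (Bool × Bool)) :
    (commonRanks w).Pairwise (fun x y => x.1 < y.1) := by
  induction w with
  | nil => simp [commonRanks]
  | cons c w ih =>
    obtain ⟨_ | _, _ | _⟩ := c <;> simp [commonRanks, List.pairwise_map, ih]
    rintro _ _ _ _ - rfl -
    exact Nat.succ_pos _

theorem commonRanks_eq_of_mem_iff {v w : List (Bool × Bool)}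
    (h : ∀ x, x ∈ commonRanks v ↔ x ∈ commonRanks w) : commonRanks v = commonRanks w := by
  have hv := pairwise_commonRanks v
  have hw := pairwise_commonRanks w
  refine List.Perm.eq_of_pairwise (fun a b _ _ h₁ h₂ => absurd h₁ h₂.not_gt) hv hw ?_
  refine (List.perm_ext_iff_of_nodup ?_ ?_).2 h
  · exact hv.imp fun h e => by simp [e] at h
  · exact hw.imp fun h e => by simp [e] at h

/-! ### Pairs of finite sets -/

variable {n : ℕ}

/-- The number of elements of `s` below `p`. -/
def rank (s : Finset (Fin n)) (p : Fin n) : ℕ := #{x ∈ s | x < p}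

theorem rank_lt_rank {s : Finset (Fin n)} {p q : Fin n} (hp : p ∈ s) (h : p < q) :
    rank s p < rank s q := by
  refine card_lt_card ((ssubset_iff_of_subset ?_).2 ⟨p, by simp [hp, h], by simp⟩)
  exact fun x hx => by
    simp only [mem_filter] at hx ⊢
    exact ⟨hx.1, hx.2.trans h⟩

theorem rank_mono (s : Finset (Fin n)) : Monotone (rank s) := fun _ _ h =>
  card_le_card fun _ hx => by
    simp only [mem_filter] at hx ⊢
    exact ⟨hx.1, hx.2.trans_le h⟩

theorem rank_injOn (s : Finset (Fin n)) : Set.InjOn (rank s) s := by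
  intro p hp q hq h
  rcases lt_trichotomy p q with h' | h' | h'
  · exact absurd h (rank_lt_rank hp h').ne
  · exact h'
  · exact absurd h (rank_lt_rank hq h').ne'

theorem image_rank (s : Finset (Fin n)) : s.image (rank s) = range #s := by
  refine eq_of_subset_of_card_le ?_ (by rw [card_image_of_injOn (rank_injOn s), card_range])
  intro r hr
  obtain ⟨p, hp, rfl⟩ := mem_image.1 hr
  rw [mem_range]
  exact card_lt_card ((ssubset_iff_of_subset (filter_subset _ _)).2 ⟨p, hp, by simp⟩)

/-- `σ` maps `s` increasingly onto `t`. -/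
def MapsIncreasing (σ : Equiv.Perm (Fin n)) (s t : Finset (Fin n)) : Prop :=
  s.image σ = t ∧ ∀ x ∈ s, ∀ y ∈ s, x < y → σ x < σ y

instance (σ : Equiv.Perm (Fin n)) (s s' : Finset (Fin n)) : Decidable (MapsIncreasing σ s s') :=
  inferInstanceAs (Decidable (_ ∧ _))

theorem mapsIncreasing_iff {σ : Equiv.Perm (Fin n)} {s s' : Finset (Fin n)} (h : #s = #s') :
    MapsIncreasing σ s s' ↔ ∀ p ∈ s, σ p ∈ s' ∧ rank s' (σ p) = rank s p := by
  constructor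
  · rintro ⟨rfl, hσ⟩ p hp
    refine ⟨mem_image_of_mem _ hp, ?_⟩
    have : {x ∈ s.image σ | x < σ p} = {x ∈ s | x < p}.image σ := by
      ext y
      simp only [mem_filter, mem_image]
      constructor
      · rintro ⟨⟨x, hx, rfl⟩, hlt⟩
        refine ⟨x, ⟨hx, ?_⟩, rfl⟩
        by_contra! hpx
        rcases hpx.eq_or_lt with rfl | hpx
        · exact lt_irrefl _ hlt
        · exact lt_asymm hlt (hσ p hp x hx hpx)
      · rintro ⟨x, ⟨hx, hlt⟩, rfl⟩
        exact ⟨⟨x, hx, rfl⟩, hσ x hx p hp hlt⟩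
    rw [rank, this, card_image_of_injective _ σ.injective, rank]
  · intro hσ
    refine ⟨eq_of_subset_of_card_le ?_ ?_, fun x hx y hy hxy => ?_⟩
    · intro y hy
      obtain ⟨x, hx, rfl⟩ := mem_image.1 hy
      exact (hσ x hx).1
    · rw [card_image_of_injective _ σ.injective, h]
    · refine (rank_mono s').reflect_lt ?_
      rw [(hσ x hx).2, (hσ y hy).2]
      exact rank_lt_rank hx hxy

/-- The word of a pair of sets: the letter at `p` records the membership of `p` in each of them. -/
def pairWord (z : Finset (Fin n) × Finset (Fin n)) (p : Fin n) : Bool × Bool :=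
  (decide (p ∈ z.1), decide (p ∈ z.2))

theorem pairWord_bijective : Function.Bijective (pairWord (n := n)) := by
  constructor
  · rintro ⟨s, t⟩ ⟨s', t'⟩ h
    have h := fun p => congrFun h p
    simp only [pairWord, Prod.mk.injEq, decide_eq_decide] at h
    exact Prod.ext (Finset.ext fun p => (h p).1) (Finset.ext fun p => (h p).2)
  · intro w
    refine ⟨(univ.filter fun p => (w p).1, univ.filter fun p => (w p).2), ?_⟩
    funext p
    simp [pairWord]

/-- The block type of a pair of sets. -/
def pairType (z : Finset (Fin n) × Finset (Fin n)) : (ℕ × ℕ) × List (ℕ × ℕ) :=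
  blockType (List.ofFn (pairWord z))

theorem card_pairType_eq (τ : (ℕ × ℕ) × List (ℕ × ℕ)) :
    #{z : Finset (Fin n) × Finset (Fin n) | pairType z = τ} =
      n.choose (weight τ) * blockCount τ := by
  rw [← card_blockType_eq]
  simp only [card_filter]
  exact (Equiv.ofBijective _ pairWord_bijective).sum_comp
    fun w => if blockType (List.ofFn w) = τ then 1 else 0

theorem card_fst_eq (z : Finset (Fin n) × Finset (Fin n)) :
    #z.1 = (pairType z).1.1 + ((pairType z).2.map Prod.fst).sum + (pairType z).2.length := by
  rw [pairType, ← sum_toNat_fst, List.map_ofFn, List.sum_ofFn]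
  simp [pairWord, Bool.toNat, Bool.cond_decide]

theorem card_snd_eq (z : Finset (Fin n) × Finset (Fin n)) :
    #z.2 = (pairType z).1.2 + ((pairType z).2.map Prod.snd).sum + (pairType z).2.length := by
  rw [pairType, ← sum_toNat_snd, List.map_ofFn, List.sum_ofFn]
  simp [pairWord, Bool.toNat, Bool.cond_decide]

theorem card_inter_eq (z : Finset (Fin n) × Finset (Fin n)) :
    #(z.1 ∩ z.2) = (pairType z).2.length := by
  rw [pairType, ← sum_toNat_and, List.map_ofFn, List.sum_ofFn]
  simp only [pairWord, Bool.toNat, Function.comp_apply, ← Bool.decide_and, Bool.cond_decide,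
    ← mem_inter, sum_boole, filter_univ_mem, Nat.cast_id]

theorem mem_commonRanks_ofFn (w : Fin n → Bool × Bool) (x : ℕ × ℕ) :
    x ∈ commonRanks (List.ofFn w) ↔
      ∃ p, w p = (true, true) ∧ x = (∑ q, if q < p then (w q).1.toNat else 0,
        ∑ q, if q < p then (w q).2.toNat else 0) := by
  induction n generalizing x with
  | zero => simp [commonRanks]
  | succ n ih =>
    rw [List.ofFn_succ, Fin.exists_fin_succ]
    simp only [commonRanks, List.mem_append, List.mem_map, ih, Fin.sum_univ_succ,
      Fin.succ_lt_succ_iff, Fin.succ_pos, Fin.not_lt_zero, if_true, if_false,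
      sum_const_zero]
    refine or_congr ?_ ⟨?_, ?_⟩
    · rcases w 0 with ⟨_ | _, _ | _⟩ <;> simp
    · rintro ⟨_, ⟨p, hp, rfl⟩, rfl⟩
      exact ⟨p, hp, by simp [add_comm]⟩
    · rintro ⟨p, hp, rfl⟩
      exact ⟨_, ⟨p, hp, rfl⟩, by simp [add_comm]⟩

theorem mem_commonRanks_pairWord (z : Finset (Fin n) × Finset (Fin n)) (x : ℕ × ℕ) :
    x ∈ commonRanks (List.ofFn (pairWord z)) ↔
      ∃ p, p ∈ z.1 ∧ p ∈ z.2 ∧ x = (rank z.1 p, rank z.2 p) := by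
  rw [mem_commonRanks_ofFn]
  have (s : Finset (Fin n)) (p : Fin n) :
      (∑ q, if q < p then (decide (q ∈ s)).toNat else 0) = rank s p := by
    simp only [Bool.toNat, Bool.cond_decide, ← ite_and]
    rw [rank, ← card_filter]
    congr 1
    ext q
    simp [and_comm]
  simp [pairWord, this, and_assoc]

theorem pairType_eq_iff {z z' : Finset (Fin n) × Finset (Fin n)} (h₁ : #z.1 = #z'.1)
    (h₂ : #z.2 = #z'.2) :
    pairType z = pairType z' ↔ ∀ x : ℕ × ℕ,
      (∃ p, p ∈ z.1 ∧ p ∈ z.2 ∧ x = (rank z.1 p, rank z.2 p)) ↔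
      ∃ p, p ∈ z'.1 ∧ p ∈ z'.2 ∧ x = (rank z'.1 p, rank z'.2 p) := by
  simp only [← mem_commonRanks_pairWord]
  constructor
  · intro h x
    rw [pairType, pairType] at h
    rw [commonRanks_eq_cumulate, commonRanks_eq_cumulate, h]
  · intro h
    have h := commonRanks_eq_of_mem_iff h
    rw [commonRanks_eq_cumulate, commonRanks_eq_cumulate] at h
    have hl := congrArg List.length h
    rw [length_cumulate, length_cumulate] at hl
    rw [card_fst_eq, card_fst_eq] at h₁
    rw [card_snd_eq, card_snd_eq] at h₂
    obtain ⟨e, e'⟩ := cumulate_injective h (by simp only [pairType] at h₁; omega)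
      (by simp only [pairType] at h₂; omega)
    exact Prod.ext e e'

/-! ### Counting permutations with prescribed increasing restrictions -/

theorem card_perm_eqOn (σ₀ : Equiv.Perm (Fin n)) (u : Finset (Fin n)) :
    #{σ : Equiv.Perm (Fin n) | ∀ p ∈ u, σ p = σ₀ p} = (n - #u).factorial := by
  have e : {σ : Equiv.Perm (Fin n) // ∀ p ∈ u, σ p = σ₀ p} ≃
      {σ : Equiv.Perm (Fin n) // ∀ p, ¬ p ∉ u → σ p = p} :=
    (Equiv.mulLeft σ₀⁻¹).subtypeEquiv fun σ => by simp [Equiv.symm_apply_eq]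
  rw [← Fintype.card_subtype, Fintype.card_congr e,
    ← Fintype.card_congr (Equiv.Perm.subtypeEquivSubtypePerm fun p => p ∉ u), Fintype.card_perm]
  congr 1
  rw [Fintype.card_subtype_compl, Fintype.card_fin, Fintype.card_coe]

theorem exists_perm_of_pairType_eq {z z' : Finset (Fin n) × Finset (Fin n)} (h₁ : #z.1 = #z'.1)
    (h₂ : #z.2 = #z'.2) (h : pairType z = pairType z') :
    ∃ σ, MapsIncreasing σ z.1 z'.1 ∧ MapsIncreasing σ z.2 z'.2 := by
  rw [pairType_eq_iff h₁ h₂] at h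
  have key : ∀ s s' : Finset (Fin n), #s = #s' → ∀ p ∈ s, ∃ q ∈ s', rank s' q = rank s p := by
    intro s s' e p hp
    have := mem_image_of_mem (rank s) hp
    rw [image_rank, e, ← image_rank] at this
    simpa using this
  obtain ⟨s, t⟩ := z
  obtain ⟨s', t'⟩ := z'
  dsimp only at h₁ h₂ h ⊢
  choose! f hf hf' using key s s' h₁
  choose! g hg hg' using key t t' h₂
  have hfg : ∀ p ∈ s, p ∈ t → f p = g p := by
    intro p hp hp'
    obtain ⟨q, hq, hq', e⟩ := (h _).1 ⟨p, hp, hp', rfl⟩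
    rw [Prod.mk.injEq] at e
    rw [rank_injOn s' (hf p hp) hq ((hf' p hp).trans e.1),
      rank_injOn t' (hg p hp') hq' ((hg' p hp').trans e.2)]
  have hcross : ∀ p ∈ s, ∀ q ∈ t, f p = g q → p = q := by
    intro p hp q hq e
    obtain ⟨r, hr, hr', e'⟩ := (h _).2 ⟨f p, hf p hp, e ▸ hg q hq, rfl⟩
    rw [Prod.mk.injEq, hf' p hp, e, hg' q hq] at e'
    rw [rank_injOn s hp hr e'.1, rank_injOn t hq hr' e'.2]
  have hinj : Set.InjOn (fun p => if p ∈ s then f p else g p) (s ∪ t : Finset (Fin n)) := by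
    intro p hp q hq e
    simp only [coe_union, Set.mem_union, mem_coe] at hp hq
    by_cases hps : p ∈ s <;> by_cases hqs : q ∈ s <;> simp only [hps, hqs, if_true, if_false] at e
    · exact rank_injOn s hps hqs (by rw [← hf' p hps, ← hf' q hqs, e])
    · exact hcross p hps q (hq.resolve_left hqs) e
    · exact (hcross q hqs p (hp.resolve_left hps) e.symm).symm
    · have hpt := hp.resolve_left hps
      have hqt := hq.resolve_left hqs
      exact rank_injOn t hpt hqt (by rw [← hg' p hpt, ← hg' q hqt, e])
  obtain ⟨σ, hσ⟩ := exists_equiv_extend_of_card_eq (t := (univ : Finset (Fin n))) (by simp)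
    (subset_univ _) hinj
  refine ⟨σ.trans (Equiv.subtypeUnivEquiv mem_univ), ?_, ?_⟩
  · rw [mapsIncreasing_iff h₁]
    intro p hp
    have : (σ p : Fin n) = f p := by rw [hσ p (mem_union_left _ hp), if_pos hp]
    simp [this, hf p hp, hf' p hp]
  · rw [mapsIncreasing_iff h₂]
    intro p hp
    have : (σ p : Fin n) = g p := by
      rw [hσ p (mem_union_right _ hp)]
      split_ifs with hps
      · exact hfg p hps hp
      · rfl
    simp [this, hg p hp, hg' p hp]

theorem pairType_eq_of_mapsIncreasing {z z' : Finset (Fin n) × Finset (Fin n)} (h₁ : #z.1 = #z'.1)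
    (h₂ : #z.2 = #z'.2) {σ : Equiv.Perm (Fin n)} (hσ₁ : MapsIncreasing σ z.1 z'.1)
    (hσ₂ : MapsIncreasing σ z.2 z'.2) : pairType z = pairType z' := by
  rw [pairType_eq_iff h₁ h₂]
  have r₁ := (mapsIncreasing_iff h₁).1 hσ₁
  have r₂ := (mapsIncreasing_iff h₂).1 hσ₂
  intro x
  constructor
  · rintro ⟨p, hp, hp', rfl⟩
    exact ⟨σ p, (r₁ p hp).1, (r₂ p hp').1, by rw [(r₁ p hp).2, (r₂ p hp').2]⟩
  · rintro ⟨q, hq, hq', rfl⟩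
    have hp := hq
    have hp' := hq'
    rw [← hσ₁.1, mem_image] at hp
    rw [← hσ₂.1, mem_image] at hp'
    obtain ⟨p, hp, rfl⟩ := hp
    obtain ⟨p', hp', e⟩ := hp'
    obtain rfl := σ.injective e
    exact ⟨p', hp, hp', by rw [(r₁ p' hp).2, (r₂ p' hp').2]⟩

theorem card_mapsIncreasing {z z' : Finset (Fin n) × Finset (Fin n)} (h₁ : #z.1 = #z'.1)
    (h₂ : #z.2 = #z'.2) :
    #{σ | MapsIncreasing σ z.1 z'.1 ∧ MapsIncreasing σ z.2 z'.2} =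
      if pairType z = pairType z' then (n - #(z.1 ∪ z.2)).factorial else 0 := by
  split_ifs with h
  · obtain ⟨σ₀, h₀, h₀'⟩ := exists_perm_of_pairType_eq h₁ h₂ h
    rw [← card_perm_eqOn σ₀]
    congr 1
    ext σ
    rw [mem_filter_univ, mem_filter_univ, mapsIncreasing_iff h₁, mapsIncreasing_iff h₂]
    rw [mapsIncreasing_iff h₁] at h₀
    rw [mapsIncreasing_iff h₂] at h₀'
    constructor
    · rintro ⟨hσ, hσ'⟩ p hp
      rcases mem_union.1 hp with hp | hp
      · exact rank_injOn z'.1 (hσ p hp).1 (h₀ p hp).1 ((hσ p hp).2.trans (h₀ p hp).2.symm)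
      · exact rank_injOn z'.2 (hσ' p hp).1 (h₀' p hp).1 ((hσ' p hp).2.trans (h₀' p hp).2.symm)
    · intro hσ
      refine ⟨fun p hp => ?_, fun p hp => ?_⟩
      · rw [hσ p (mem_union_left _ hp)]
        exact h₀ p hp
      · rw [hσ p (mem_union_right _ hp)]
        exact h₀' p hp
  · rw [card_eq_zero, filter_eq_empty_iff]
    rintro σ - ⟨hσ, hσ'⟩
    exact h (pairType_eq_of_mapsIncreasing h₁ h₂ hσ hσ')

/-! ### The second moment -/

theorem Z_eq_sum (k : ℕ) (σ : Equiv.Perm (Fin n)) :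
    Z n k σ = ∑ s ∈ powersetCard k univ, ∑ s' ∈ powersetCard k univ,
      if MapsIncreasing σ s s' then 1 else 0 := by
  rw [Z, card_filter]
  refine sum_congr rfl fun s hs => ?_
  have hmem : s.image σ ∈ powersetCard k univ := by
    rw [mem_powersetCard_univ] at hs ⊢
    rw [card_image_of_injective _ σ.injective, hs]
  rw [sum_eq_single_of_mem _ hmem fun s' _ hs' => if_neg fun h => hs' h.1.symm]
  simp [MapsIncreasing]

theorem sum_Z_sq (n k : ℕ) :
    ∑ σ, Z n k σ ^ 2 = ∑ z ∈ powersetCard k (univ : Finset (Fin n)) ×ˢ powersetCard k univ,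
      ∑ z' ∈ powersetCard k (univ : Finset (Fin n)) ×ˢ powersetCard k univ,
        if pairType z = pairType z' then (n - #(z.1 ∪ z.2)).factorial else 0 := by
  have hZ : ∀ σ, Z n k σ ^ 2 =
      ∑ z ∈ powersetCard k (univ : Finset (Fin n)) ×ˢ powersetCard k univ,
      ∑ z' ∈ powersetCard k (univ : Finset (Fin n)) ×ˢ powersetCard k univ,
        if MapsIncreasing σ z.1 z'.1 ∧ MapsIncreasing σ z.2 z'.2 then 1 else 0 := by
    intro σ
    rw [sq, Z_eq_sum, sum_mul_sum, sum_product]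
    refine sum_congr rfl fun s _ => sum_congr rfl fun t _ => ?_
    rw [sum_mul_sum, sum_product]
    refine sum_congr rfl fun s' _ => sum_congr rfl fun t' _ => ?_
    rw [ite_and, ite_zero_mul, one_mul]
  simp_rw [hZ]
  rw [sum_comm]
  refine sum_congr rfl fun z hz => ?_
  rw [sum_comm]
  refine sum_congr rfl fun z' hz' => ?_
  simp only [mem_product, mem_powersetCard_univ] at hz hz'
  rw [← card_filter, card_mapsIncreasing (hz.1.trans hz'.1.symm) (hz.2.trans hz'.2.symm)]

/-- The block type given by tuples `l` and `m` of block sizes. -/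
def typeOfTuples {j : ℕ} (l m : Fin (j + 1) → ℕ) : (ℕ × ℕ) × List (ℕ × ℕ) :=
  ((l 0, m 0), List.ofFn fun r : Fin j => (l r.succ, m r.succ))

theorem weight_typeOfTuples {j : ℕ} (l m : Fin (j + 1) → ℕ) :
    weight (typeOfTuples l m) = ∑ r, l r + ∑ r, m r + j := by
  simp only [weight, typeOfTuples, List.map_ofFn, List.sum_ofFn, Function.comp_apply,
    Fin.sum_univ_succ, sum_add_distrib, sum_const, card_univ, Fintype.card_fin]
  simp
  ring

theorem blockCount_typeOfTuples {j : ℕ} (l m : Fin (j + 1) → ℕ) :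
    blockCount (typeOfTuples l m) = ∏ r, (l r + m r).choose (l r) := by
  simp [blockCount, typeOfTuples, List.map_ofFn, List.prod_ofFn, Fin.prod_univ_succ]

/-- The tuples of block sizes of pairs of `k`-element sets. -/
def tuples (k : ℕ) : Finset (Σ j : ℕ, (Fin (j + 1) → ℕ) × (Fin (j + 1) → ℕ)) :=
  (range (k + 1)).sigma fun j =>
    Finset.Nat.antidiagonalTuple (j + 1) (k - j) ×ˢ Finset.Nat.antidiagonalTuple (j + 1) (k - j)

theorem typeOfTuples_injective : Function.Injective
    fun x : Σ j : ℕ, (Fin (j + 1) → ℕ) × (Fin (j + 1) → ℕ) => typeOfTuples x.2.1 x.2.2 := by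
  rintro ⟨j, l, m⟩ ⟨j', l', m'⟩ h
  simp only [typeOfTuples, Prod.mk.injEq] at h
  obtain ⟨⟨h₁, h₂⟩, h₃⟩ := h
  obtain rfl : j = j' := by simpa using congrArg List.length h₃
  have h₃ := fun r => congrFun (List.ofFn_injective h₃) r
  simp only [Prod.mk.injEq] at h₃
  have hl : l = l' := funext fun r => Fin.cases h₁ (fun r => (h₃ r).1) r
  have hm : m = m' := funext fun r => Fin.cases h₂ (fun r => (h₃ r).2) r
  rw [hl, hm]

theorem exists_typeOfTuples_eq (τ : (ℕ × ℕ) × List (ℕ × ℕ)) :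
    ∃ l m : Fin (τ.2.length + 1) → ℕ, typeOfTuples l m = τ := by
  refine ⟨Fin.cons τ.1.1 fun r => (τ.2.get r).1, Fin.cons τ.1.2 fun r => (τ.2.get r).2, ?_⟩
  simp [typeOfTuples]

theorem card_fst_typeOfTuples {z : Finset (Fin n) × Finset (Fin n)} {j : ℕ}
    {l m : Fin (j + 1) → ℕ} (h : pairType z = typeOfTuples l m) :
    #z.1 = ∑ r, l r + j ∧ #z.2 = ∑ r, m r + j ∧ #(z.1 ∩ z.2) = j := by
  rw [card_fst_eq, card_snd_eq, card_inter_eq, h]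
  simp [typeOfTuples, List.map_ofFn, List.sum_ofFn, Fin.sum_univ_succ, Function.comp_def]

theorem exists_tuples_of_card {k : ℕ} {z : Finset (Fin n) × Finset (Fin n)} (h₁ : #z.1 = k)
    (h₂ : #z.2 = k) : ∃ x ∈ tuples k, typeOfTuples x.2.1 x.2.2 = pairType z := by
  obtain ⟨l, m, h⟩ := exists_typeOfTuples_eq (pairType z)
  refine ⟨⟨_, l, m⟩, ?_, h⟩
  have := card_fst_typeOfTuples h.symm
  simp only [tuples, mem_sigma, mem_range, mem_product, Finset.Nat.mem_antidiagonalTuple]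
  omega

theorem sum_Z_sq_eq_sum_tuples (n k : ℕ) :
    ∑ σ, Z n k σ ^ 2 = ∑ x ∈ tuples k,
      (n.choose (2 * k - x.1) * ∏ r, (x.2.1 r + x.2.2 r).choose (x.2.1 r)) ^ 2 *
        (n - (2 * k - x.1)).factorial := by
  set P := powersetCard k (univ : Finset (Fin n)) ×ˢ powersetCard k (univ : Finset (Fin n)) with hP
  have hmaps : ∀ z ∈ P, pairType z ∈ (tuples k).image fun x => typeOfTuples x.2.1 x.2.2 := by
    intro z hz
    simp only [hP, mem_product, mem_powersetCard_univ] at hz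
    exact mem_image.2 (exists_tuples_of_card hz.1 hz.2)
  rw [sum_Z_sq, ← sum_fiberwise_of_maps_to hmaps,
    sum_image fun x _ y _ h => typeOfTuples_injective h]
  refine sum_congr rfl fun ⟨j, l, m⟩ hx => ?_
  simp only [tuples, mem_sigma, mem_range, mem_product, Finset.Nat.mem_antidiagonalTuple] at hx
  obtain ⟨hj, hl, hm⟩ := hx
  have hfiber : #{z ∈ P | pairType z = typeOfTuples l m} =
      n.choose (2 * k - j) * ∏ r, (l r + m r).choose (l r) := by
    rw [← blockCount_typeOfTuples,
      show 2 * k - j = weight (typeOfTuples l m) by rw [weight_typeOfTuples]; omega,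
      ← card_pairType_eq]
    congr 1
    ext z
    simp only [hP, mem_filter, mem_product, mem_powersetCard_univ, mem_univ, true_and,
      and_iff_right_iff_imp]
    intro h
    have := card_fst_typeOfTuples h
    omega
  dsimp only
  rw [← hfiber, sq, mul_assoc, ← smul_eq_mul, ← sum_const]
  refine sum_congr rfl fun z hz => ?_
  rw [mem_filter] at hz
  have hu : #(z.1 ∪ z.2) = 2 * k - j := by
    have := card_fst_typeOfTuples hz.2
    have := card_union_add_card_inter z.1 z.2
    omega
  rw [hz.2, hu, ← sum_filter, sum_const, smul_eq_mul]
  simp only [eq_comm, hP]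

theorem choose_sq_mul_factorial_div (n u : ℕ) :
    (n.choose u : ℝ) ^ 2 * (n - u).factorial / n.factorial = n.choose u / u.factorial := by
  rcases le_or_gt u n with h | h
  · have e : (n.choose u : ℝ) * u.factorial * (n - u).factorial = n.factorial := by
      exact_mod_cast Nat.choose_mul_factorial_mul_factorial h
    rw [div_eq_div_iff (by positivity) (by positivity), ← e]
    ring
  · simp [Nat.choose_eq_zero_of_lt h]

end IncreasingSubsequences

/-- The second moment of `Z_{n,k}` under the uniform measure on `S_n`:
`E[Z_{n,k}²] = ∑_{j=0}^{k} C(n,2k−j) · A(k−j,j) / (2k−j)!`. -/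
theorem second_moment_formula (n k : ℕ) (hk1 : 1 ≤ k) (hkn : k ≤ n) :
    (∑ σ : Equiv.Perm (Fin n), ((Z n k σ : ℝ))^2) / (n.factorial : ℝ)
      = ∑ j ∈ Finset.range (k+1),
          (n.choose (2*k - j) : ℝ) * (A (k - j) j : ℝ) / ((2*k - j).factorial : ℝ) := by
  have h := IncreasingSubsequences.sum_Z_sq_eq_sum_tuples n k
  rw [IncreasingSubsequences.tuples, Finset.sum_sigma] at h
  have h := congrArg (Nat.cast : ℕ → ℝ) h
  rw [Nat.cast_sum, Nat.cast_sum] at h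
  simp only [Nat.cast_pow] at h
  rw [h, Finset.sum_div]
  refine Finset.sum_congr rfl fun j _ => ?_
  rw [mul_div_right_comm, ← IncreasingSubsequences.choose_sq_mul_factorial_div, A,
    ← Finset.sum_product', Nat.cast_sum, Nat.cast_sum, Finset.sum_div, Finset.mul_sum]
  refine Finset.sum_congr rfl fun x _ => ?_
  push_cast
  rw [mul_pow, Finset.prod_pow]
  ring
end

section
/- Let 1 ≤ k ≤ n and 0 ≤ j ≤ k with 2k − j ≤ n. Let X = {x_1<…<x_k} and Y = {y_1<…<y_k} be k-element subsets of {1,…,n} with |X ∩ Y| = j, with interlacing numbers (l_0,…,l_j) and (m_0,…,m_j). Then the number of permutations σ of {1,…,n} for which both X and Y are increasing subsequences of σ (i.e. σ is strictly increasing on X and strictly increasing on Y) equals (n!/(2k−j)!)·∏_{r=0}^{j} C(l_r+m_r, l_r). -/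
open Finset

section LinearExtensions

variable {α : Type*} [DecidableEq α]

/-- The orderings of the finite set `S` as a list in which every pair of entries satisfies `Q`. -/
noncomputable def pairwiseOrderings (Q : α → α → Prop) [DecidableRel Q] (S : Finset α) : Finset (List α) :=
  S.toList.permutations.toFinset.filter (fun L => L.Pairwise Q)

lemma mem_pairwiseOrderings {Q : α → α → Prop} [DecidableRel Q] {S : Finset α} {L : List α} :
    L ∈ pairwiseOrderings Q S ↔ (L.Nodup ∧ ∀ a, a ∈ L ↔ a ∈ S) ∧ L.Pairwise Q := by
  have h : L.Perm S.toList ↔ L.Nodup ∧ ∀ a, a ∈ L ↔ a ∈ S := by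
    constructor
    · intro h
      exact ⟨h.nodup_iff.mpr S.nodup_toList, fun a => by rw [h.mem_iff, mem_toList]⟩
    · rintro ⟨h1, h2⟩
      rw [List.perm_ext_iff_of_nodup h1 S.nodup_toList]
      simpa using h2
  simp [pairwiseOrderings, h]

lemma card_pairwiseOrderings_empty (Q : α → α → Prop) [DecidableRel Q] :
    (pairwiseOrderings Q ∅).card = 1 := by
  rw [card_eq_one]
  refine ⟨[], ?_⟩
  ext L
  rw [mem_pairwiseOrderings, mem_singleton]
  constructor
  · rintro ⟨⟨-, h⟩, -⟩
    exact List.eq_nil_iff_forall_not_mem.mpr (by simpa using h)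
  · rintro rfl
    simp

/-- Orderings are counted by their first entry. -/
lemma card_pairwiseOrderings (Q : α → α → Prop) [DecidableRel Q] {S : Finset α}
    (hS : S.Nonempty) :
    (pairwiseOrderings Q S).card =
      ∑ s ∈ S.filter (fun s => ∀ b ∈ S.erase s, Q s b), (pairwiseOrderings Q (S.erase s)).card := by
  have h : pairwiseOrderings Q S = (S.filter (fun s => ∀ b ∈ S.erase s, Q s b)).biUnion
      (fun s => (pairwiseOrderings Q (S.erase s)).image (List.cons s)) := by
    ext L
    simp only [mem_biUnion, mem_image, mem_filter, mem_pairwiseOrderings]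
    constructor
    · rintro ⟨⟨h1, h2⟩, h3⟩
      cases L with
      | nil =>
        obtain ⟨s, hs⟩ := hS
        simpa using (h2 s).mpr hs
      | cons s L =>
        rw [List.nodup_cons] at h1
        rw [List.pairwise_cons] at h3
        have h4 : ∀ a, a ∈ L ↔ a ∈ S.erase s := by
          intro a
          have := h2 a
          rw [List.mem_cons] at this
          rw [mem_erase]
          constructor
          · intro ha
            exact ⟨fun h => h1.1 (h ▸ ha), this.mp (Or.inr ha)⟩
          · rintro ⟨ha, hb⟩
            exact (this.mpr hb).resolve_left ha
        exact ⟨s, ⟨(h2 s).mp (by simp), fun b hb => h3.1 b ((h4 b).mpr hb)⟩, L,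
          ⟨⟨h1.2, h4⟩, h3.2⟩, rfl⟩
    · rintro ⟨s, ⟨hs, hQ⟩, L, ⟨⟨h1, h2⟩, h3⟩, rfl⟩
      refine ⟨⟨List.nodup_cons.mpr ⟨fun h => by simpa using (h2 s).mp h, h1⟩, fun a => ?_⟩,
        List.pairwise_cons.mpr ⟨fun b hb => hQ b ((h2 b).mp hb), h3⟩⟩
      rw [List.mem_cons, h2, mem_erase]
      by_cases ha : a = s
      · simp [ha, hs]
      · simp [ha]
  rw [h, card_biUnion]
  · exact sum_congr rfl fun s _ => card_image_of_injective _ List.cons_injective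
  · intro a _ b _ hab
    rw [Function.onFun, disjoint_left]
    intro L h1 h2
    rw [mem_image] at h1 h2
    obtain ⟨L1, -, rfl⟩ := h1
    obtain ⟨L2, -, h⟩ := h2
    exact hab (List.cons.inj h).1.symm

end LinearExtensions

section TwoChains

variable {α : Type*} [LinearOrder α]

/-- `a` may precede `b` when both `X` and `Y` have to appear in increasing order. -/
def MayPrecede (X Y : Finset α) (a b : α) : Prop :=
  ¬ (b < a ∧ ((a ∈ X ∧ b ∈ X) ∨ (a ∈ Y ∧ b ∈ Y)))

instance (X Y : Finset α) : DecidableRel (MayPrecede X Y) := fun a b => by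
  unfold MayPrecede; infer_instance

/-- The number of common elements of `X` and `Y` below `x`. -/
def commonBelow (X Y : Finset α) (x : α) : ℕ := ((X ∩ Y).filter (fun z => z < x)).card

lemma commonBelow_comm (X Y : Finset α) (x : α) : commonBelow Y X x = commonBelow X Y x := by
  rw [commonBelow, commonBelow, inter_comm]

lemma commonBelow_le (X Y : Finset α) (x : α) : commonBelow X Y x ≤ (X ∩ Y).card :=
  card_filter_le _ _

lemma commonBelow_mono (X Y : Finset α) : Monotone (commonBelow X Y) := fun _ _ h =>
  card_le_card (monotone_filter_right _ fun _ _ hz => lt_of_lt_of_le hz h)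

lemma commonBelow_lt {X Y : Finset α} {z x : α} (hz : z ∈ X ∩ Y) (h : z < x) :
    commonBelow X Y z < commonBelow X Y x := by
  refine card_lt_card (ssubset_iff_of_subset
    (monotone_filter_right _ fun _ _ hw => lt_trans hw h) |>.mpr ⟨z, ?_, ?_⟩)
  · exact mem_filter.mpr ⟨hz, h⟩
  · simp

lemma exists_common_of_commonBelow_lt {X Y : Finset α} {x y : α}
    (h : commonBelow X Y x < commonBelow X Y y) : ∃ z ∈ X ∩ Y, x ≤ z ∧ z < y := by
  by_contra! hc
  refine absurd h (not_lt.mpr (card_le_card fun z hz => ?_))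
  rw [mem_filter] at hz ⊢
  exact ⟨hz.1, lt_of_not_ge fun hxz => absurd hz.2 (not_lt.mpr (hc z hz.1 hxz))⟩

/-- The number of elements of `S` lying in `X` but not in `Y` with exactly `r` common elements
below them. -/
def gapCard (X Y S : Finset α) (r : ℕ) : ℕ :=
  (S.filter (fun x => (x ∈ X ∧ x ∉ Y) ∧ commonBelow X Y x = r)).card

lemma gapCard_erase_of_notMem {X Y S : Finset α} {s : α} (hs : ¬ (s ∈ X ∧ s ∉ Y)) (r : ℕ) :
    gapCard X Y (S.erase s) r = gapCard X Y S r := by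
  rw [gapCard, filter_erase, erase_eq_of_notMem, gapCard]
  simp only [mem_filter]
  tauto

lemma gapCard_erase_of_ne {X Y S : Finset α} {s : α} {r : ℕ} (hr : commonBelow X Y s ≠ r) :
    gapCard X Y (S.erase s) r = gapCard X Y S r := by
  rw [gapCard, filter_erase, erase_eq_of_notMem, gapCard]
  simp only [mem_filter]
  tauto

lemma gapCard_erase_add_one {X Y S : Finset α} {s : α} (hs : s ∈ S) (hX : s ∈ X) (hY : s ∉ Y) :
    gapCard X Y (S.erase s) (commonBelow X Y s) + 1 = gapCard X Y S (commonBelow X Y s) := by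
  rw [gapCard, filter_erase, gapCard, card_erase_add_one]
  simp [hs, hX, hY]

/-- The product of the binomial coefficients counting the shuffles of the gaps. -/
def gapProd (X Y S : Finset α) : ℕ :=
  ∏ r ∈ range ((X ∩ Y).card + 1),
    (gapCard X Y S r + gapCard Y X S r).choose (gapCard X Y S r)

lemma gapProd_comm (X Y S : Finset α) : gapProd Y X S = gapProd X Y S := by
  rw [gapProd, gapProd, inter_comm]
  exact prod_congr rfl fun r _ => by rw [add_comm, Nat.choose_symm_add]

lemma gapProd_erase_of_iff {X Y S : Finset α} {s : α} (hs : s ∈ X ↔ s ∈ Y) :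
    gapProd X Y (S.erase s) = gapProd X Y S :=
  prod_congr rfl fun r _ => by
    rw [gapCard_erase_of_notMem (by tauto), gapCard_erase_of_notMem (by tauto)]

/-- The part of `gapProd` that comes from the gaps other than `r`. -/
def gapProdExcept (X Y S : Finset α) (r : ℕ) : ℕ :=
  ∏ i ∈ (range ((X ∩ Y).card + 1)).erase r,
    (gapCard X Y S i + gapCard Y X S i).choose (gapCard X Y S i)

lemma gapProd_eq_mul (X Y S : Finset α) (x : α) :
    gapProd X Y S = (gapCard X Y S (commonBelow X Y x) +
      gapCard Y X S (commonBelow X Y x)).choose (gapCard X Y S (commonBelow X Y x)) *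
      gapProdExcept X Y S (commonBelow X Y x) :=
  (mul_prod_erase _ _ (mem_range.mpr (Nat.lt_succ_of_le (commonBelow_le X Y x)))).symm

lemma gapProdExcept_erase (X Y S : Finset α) (x : α) :
    gapProdExcept X Y (S.erase x) (commonBelow X Y x) =
      gapProdExcept X Y S (commonBelow X Y x) :=
  prod_congr rfl fun i hi => by
    have h := (mem_erase.mp hi).1.symm
    rw [gapCard_erase_of_ne h, gapCard_erase_of_ne (by rwa [commonBelow_comm])]

/-- The elements of `S` in `X ∪ Y` that may come first. -/
def firstChoices (X Y S : Finset α) : Finset α :=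
  S.filter (fun s => s ∈ X ∪ Y ∧ ∀ b ∈ S.erase s, MayPrecede X Y s b)

lemma firstChoices_comm (X Y S : Finset α) : firstChoices Y X S = firstChoices X Y S := by
  ext s
  simp only [firstChoices, mem_filter, union_comm Y X]
  simp only [MayPrecede, or_comm]

lemma mem_firstChoices {X Y S : Finset α} {s : α} :
    s ∈ firstChoices X Y S ↔ (s ∈ S ∧ (s ∈ X ∨ s ∈ Y)) ∧
      (s ∈ X → ∀ b ∈ S, b ∈ X → s ≤ b) ∧ (s ∈ Y → ∀ b ∈ S, b ∈ Y → s ≤ b) := by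
  simp only [firstChoices, mem_filter, mem_union, and_assoc]
  simp only [MayPrecede, mem_erase]
  refine and_congr_right fun _ => and_congr_right fun _ => ?_
  constructor
  · intro h
    constructor
    · intro hs b hb hbX
      by_contra! hlt
      exact h b ⟨hlt.ne, hb⟩ ⟨hlt, Or.inl ⟨hs, hbX⟩⟩
    · intro hs b hb hbY
      by_contra! hlt
      exact h b ⟨hlt.ne, hb⟩ ⟨hlt, Or.inr ⟨hs, hbY⟩⟩
  · rintro ⟨h1, h2⟩ b ⟨-, hb⟩ ⟨hlt, ⟨hs, hbX⟩ | ⟨hs, hbY⟩⟩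
    · exact absurd (h1 hs b hb hbX) (not_le.mpr hlt)
    · exact absurd (h2 hs b hb hbY) (not_le.mpr hlt)

/-- Every common element of `X` and `Y` outside `S` lies below all elements of `S` in `X ∪ Y`. -/
def CommonInitial (X Y S : Finset α) : Prop :=
  ∀ z ∈ X ∩ Y, z ∉ S → ∀ x ∈ S, x ∈ X ∪ Y → z < x

lemma CommonInitial.symm {X Y S : Finset α} (h : CommonInitial X Y S) : CommonInitial Y X S := by
  rw [CommonInitial, inter_comm, union_comm]
  exact h

lemma CommonInitial.erase_firstChoices {X Y S : Finset α} {s : α} (h : CommonInitial X Y S)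
    (hs : s ∈ firstChoices X Y S) : CommonInitial X Y (S.erase s) := by
  intro z hz hzS x hx hxU
  rw [mem_erase] at hx
  by_cases hzs : z = s
  · subst hzs
    rw [mem_firstChoices] at hs
    rw [mem_inter] at hz
    refine lt_of_le_of_ne ?_ hx.1.symm
    rcases mem_union.mp hxU with hxX | hxY
    · exact hs.2.1 hz.1 x hx.2 hxX
    · exact hs.2.2 hz.2 x hx.2 hxY
  · exact h z hz (fun hzS' => hzS (mem_erase.mpr ⟨hzs, hzS'⟩)) x hx.2 hxU

lemma CommonInitial.erase_of_notMem {X Y S : Finset α} {s : α} (h : CommonInitial X Y S)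
    (hs : s ∉ X ∪ Y) : CommonInitial X Y (S.erase s) := by
  intro z hz hzS x hx hxU
  refine h z hz (fun hzS' => hzS (mem_erase.mpr ⟨?_, hzS'⟩)) x (mem_of_mem_erase hx) hxU
  rintro rfl
  exact hs (mem_union_left _ (mem_inter.mp hz).1)

lemma sum_gapProd_firstChoices_of_min_left {X Y S : Finset α} (h : CommonInitial X Y S) {t : α}
    (htS : t ∈ S) (htX : t ∈ X) (htY : t ∉ Y) (hmin : ∀ b ∈ S, b ∈ X ∪ Y → t ≤ b) :
    ∑ s ∈ firstChoices X Y S, gapProd X Y (S.erase s) = gapProd X Y S := by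
  have htF : t ∈ firstChoices X Y S := mem_firstChoices.mpr ⟨⟨htS, Or.inl htX⟩,
    fun _ b hb hbX => hmin b hb (mem_union_left _ hbX), fun hY => absurd hY htY⟩
  have hother : ∀ y ∈ firstChoices X Y S, y ≠ t →
      (y ∈ S ∧ y ∈ Y ∧ y ∉ X ∧ ∀ b ∈ S, b ∈ Y → y ≤ b) ∧
        commonBelow X Y y = commonBelow X Y t := by
    intro y hy hyt
    rw [mem_firstChoices] at hy
    obtain ⟨⟨hyS, hyU⟩, hyX, hyY⟩ := hy
    have hty := hmin y hyS (mem_union.mpr hyU)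
    have hynX : y ∉ X := fun hx => hyt (le_antisymm (hyX hx t htS htX) hty)
    have hyY' := hyU.resolve_left hynX
    refine ⟨⟨hyS, hyY', hynX, hyY hyY'⟩, ?_⟩
    refine le_antisymm (not_lt.mp fun hlt => ?_) (commonBelow_mono X Y hty)
    obtain ⟨z, hz, htz, hzy⟩ := exists_common_of_commonBelow_lt hlt
    by_cases hzS : z ∈ S
    · exact absurd (hyY hyY' z hzS (mem_inter.mp hz).2) (not_le.mpr hzy)
    · exact absurd (h z hz hzS t htS (mem_union_left _ htX)) (not_lt.mpr htz)
  have ha := gapCard_erase_add_one htS htX htY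
  have hb : gapCard Y X (S.erase t) (commonBelow X Y t) = gapCard Y X S (commonBelow X Y t) :=
    gapCard_erase_of_notMem (by tauto) _
  have hPt := gapProd_eq_mul X Y (S.erase t) t
  rw [gapProdExcept_erase, hb] at hPt
  by_cases hex : ∃ y ∈ firstChoices X Y S, y ≠ t
  · obtain ⟨y, hyF, hyt⟩ := hex
    obtain ⟨⟨hyS, hyY, hyX, hymin⟩, hyr⟩ := hother y hyF hyt
    have hF : firstChoices X Y S = {t, y} := by
      ext s
      rw [mem_insert, mem_singleton]
      constructor
      · intro hs
        by_cases hst : s = t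
        · exact Or.inl hst
        · obtain ⟨⟨hsS, hsY, -, hsmin⟩, -⟩ := hother s hs hst
          exact Or.inr (le_antisymm (hsmin y hyS hyY) (hymin s hsS hsY))
      · rintro (rfl | rfl)
        · exact htF
        · exact hyF
    have hPy := gapProd_eq_mul X Y (S.erase y) y
    have hb' := gapCard_erase_add_one hyS hyY hyX
    rw [commonBelow_comm, hyr] at hb'
    rw [gapProdExcept_erase, hyr, gapCard_erase_of_notMem (by tauto)] at hPy
    rw [hF, sum_pair hyt.symm, hPt, hPy, gapProd_eq_mul X Y S t, ← ha, ← hb', ← add_mul]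
    congr 1
    rw [show ∀ a b : ℕ, a + 1 + (b + 1) = (a + b + 1) + 1 by intros; ring, Nat.choose_succ_succ]
    congr 2
    ring
  · push Not at hex
    have hF : firstChoices X Y S = {t} := eq_singleton_iff_unique_mem.mpr ⟨htF, hex⟩
    have hb0 : gapCard Y X S (commonBelow X Y t) = 0 := by
      rw [gapCard, card_eq_zero, filter_eq_empty_iff]
      rintro w hw ⟨⟨hwY, hwX⟩, hwr⟩
      rw [commonBelow_comm] at hwr
      obtain ⟨y, hy, hymin⟩ := exists_min_image (S.filter (· ∈ Y)) id
        ⟨w, mem_filter.mpr ⟨hw, hwY⟩⟩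
      simp only [mem_filter, id, and_imp] at hy hymin
      have hyX : y ∉ X := by
        intro hyX
        have hyw : y < w := lt_of_le_of_ne (hymin w hw hwY) fun e => hwX (e ▸ hyX)
        have h1 := commonBelow_lt (mem_inter.mpr ⟨hyX, hy.2⟩) hyw
        have h2 := commonBelow_mono X Y (hmin y hy.1 (mem_union_left _ hyX))
        omega
      have hyF : y ∈ firstChoices X Y S := mem_firstChoices.mpr
        ⟨⟨hy.1, Or.inr hy.2⟩, fun hX => absurd hX hyX, fun _ b hb hbY => hymin b hb hbY⟩
      exact htY (hex y hyF ▸ hy.2)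
    rw [hF, sum_singleton, hPt, gapProd_eq_mul X Y S t, hb0]
    simp

lemma sum_gapProd_firstChoices {X Y S : Finset α} (h : CommonInitial X Y S)
    (hne : (S ∩ (X ∪ Y)).Nonempty) :
    ∑ s ∈ firstChoices X Y S, gapProd X Y (S.erase s) = gapProd X Y S := by
  obtain ⟨t, ht, hmin⟩ := exists_min_image _ id hne
  simp only [mem_inter, id, and_imp] at ht hmin
  by_cases htX : t ∈ X
  · by_cases htY : t ∈ Y
    · have hF : firstChoices X Y S = {t} := by
        rw [eq_singleton_iff_unique_mem, mem_firstChoices]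
        refine ⟨⟨⟨ht.1, Or.inl htX⟩, fun _ b hb hbX => hmin b hb (mem_union_left _ hbX),
          fun _ b hb hbY => hmin b hb (mem_union_right _ hbY)⟩, fun s hs => ?_⟩
        rw [mem_firstChoices] at hs
        refine le_antisymm ?_ (hmin s hs.1.1 (mem_union.mpr hs.1.2))
        rcases hs.1.2 with hX | hY
        · exact hs.2.1 hX t ht.1 htX
        · exact hs.2.2 hY t ht.1 htY
      rw [hF, sum_singleton, gapProd_erase_of_iff (by tauto)]
    · exact sum_gapProd_firstChoices_of_min_left h ht.1 htX htY hmin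
  · have htY : t ∈ Y := (mem_union.mp ht.2).resolve_left htX
    rw [← firstChoices_comm, ← gapProd_comm]
    simp_rw [← gapProd_comm X Y]
    exact sum_gapProd_firstChoices_of_min_left h.symm ht.1 htY htX
      (by rwa [union_comm])

theorem card_pairwiseOrderings_mayPrecede (X Y : Finset α) (N : ℕ) :
    ∀ S : Finset α, S.card = N → CommonInitial X Y S →
      (pairwiseOrderings (MayPrecede X Y) S).card * (S ∩ (X ∪ Y)).card.factorial =
        N.factorial * gapProd X Y S := by
  induction N with
  | zero =>
    intro S hS _
    rw [card_eq_zero] at hS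
    subst hS
    rw [card_pairwiseOrderings_empty]
    simp [gapProd, gapCard]
  | succ N ih =>
    intro S hS h
    have hsplit : S.filter (fun s => ∀ b ∈ S.erase s, MayPrecede X Y s b) =
        (S \ (X ∪ Y)) ∪ firstChoices X Y S := by
      ext s
      by_cases hs : s ∈ X ∪ Y
      · simp only [firstChoices, mem_filter, mem_union, mem_sdiff] at hs ⊢
        tauto
      · have : ∀ b ∈ S.erase s, MayPrecede X Y s b := by
          intro b _ hb
          rw [mem_union] at hs
          tauto
        simp only [firstChoices, mem_filter, mem_union (s := S \ (X ∪ Y)), mem_sdiff]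
        tauto
    have hdisj : Disjoint (S \ (X ∪ Y)) (firstChoices X Y S) := by
      rw [disjoint_left]
      intro s h1 h2
      exact (mem_sdiff.mp h1).2 (mem_filter.mp h2).2.1
    rw [card_pairwiseOrderings _ (card_pos.mp (by omega)), hsplit, sum_union hdisj, add_mul,
      sum_mul, sum_mul]
    have h1 : ∀ s ∈ S \ (X ∪ Y), (pairwiseOrderings (MayPrecede X Y) (S.erase s)).card *
        (S ∩ (X ∪ Y)).card.factorial = N.factorial * gapProd X Y S := by
      intro s hs
      rw [mem_sdiff] at hs
      have := ih (S.erase s) (by rw [card_erase_of_mem hs.1, hS]; rfl) (h.erase_of_notMem hs.2)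
      rwa [erase_inter, erase_eq_of_notMem (s := S ∩ (X ∪ Y)) (by simp only [mem_inter]; tauto),
        gapProd_erase_of_iff (by rw [mem_union] at hs; tauto)] at this
    have h2 : ∀ s ∈ firstChoices X Y S, (pairwiseOrderings (MayPrecede X Y) (S.erase s)).card *
        (S ∩ (X ∪ Y)).card.factorial =
        (S ∩ (X ∪ Y)).card * N.factorial * gapProd X Y (S.erase s) := by
      intro s hs
      have hs' := mem_firstChoices.mp hs
      have hsU : s ∈ S ∩ (X ∪ Y) := mem_inter.mpr ⟨hs'.1.1, mem_union.mpr hs'.1.2⟩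
      have := ih (S.erase s) (by rw [card_erase_of_mem hs'.1.1, hS]; rfl)
        (h.erase_firstChoices hs)
      rw [erase_inter, card_erase_of_mem hsU] at this
      rw [← Nat.mul_factorial_pred (card_pos.mpr ⟨s, hsU⟩).ne', mul_left_comm, this, mul_assoc]
    rw [sum_congr rfl h1, sum_congr rfl h2, sum_const, ← mul_sum, smul_eq_mul]
    have h3 : (S ∩ (X ∪ Y)).card * N.factorial *
        ∑ s ∈ firstChoices X Y S, gapProd X Y (S.erase s) =
        (S ∩ (X ∪ Y)).card * N.factorial * gapProd X Y S := by
      rcases (S ∩ (X ∪ Y)).eq_empty_or_nonempty with he | hne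
      · simp [he]
      · rw [sum_gapProd_firstChoices h hne]
    have hcard := card_sdiff_add_card_inter S (X ∪ Y)
    rw [h3, Nat.factorial_succ, ← hS, ← hcard]
    ring

end TwoChains

/-- Listing the preimages of `0, …, n - 1` turns permutations that are increasing on `X` and on `Y`
into orderings. -/
lemma card_perm_increasing (n : ℕ) (X Y : Finset (Fin n)) :
    (univ.filter (fun σ : Equiv.Perm (Fin n) =>
        (∀ x ∈ X, ∀ y ∈ X, x < y → σ x < σ y) ∧
        (∀ x ∈ Y, ∀ y ∈ Y, x < y → σ x < σ y))).card =
      (pairwiseOrderings (MayPrecede X Y) univ).card := by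
  have key : ∀ σ : Equiv.Perm (Fin n), (List.ofFn σ.symm).Pairwise (MayPrecede X Y) ↔
      ((∀ x ∈ X, ∀ y ∈ X, x < y → σ x < σ y) ∧ (∀ x ∈ Y, ∀ y ∈ Y, x < y → σ x < σ y)) := by
    intro σ
    rw [List.pairwise_ofFn]
    constructor
    · intro h
      have aux : ∀ x y, x < y → ((y ∈ X ∧ x ∈ X) ∨ (y ∈ Y ∧ x ∈ Y)) → σ x < σ y := by
        intro x y hxy hm
        by_contra! hle
        have hlt : σ y < σ x := lt_of_le_of_ne hle fun e => hxy.ne' (σ.injective e)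
        have := h hlt
        rw [σ.symm_apply_apply, σ.symm_apply_apply] at this
        exact this ⟨hxy, hm⟩
      exact ⟨fun x hx y hy hxy => aux x y hxy (Or.inl ⟨hy, hx⟩),
        fun x hx y hy hxy => aux x y hxy (Or.inr ⟨hy, hx⟩)⟩
    · rintro ⟨h1, h2⟩ i j hij ⟨hlt, ⟨hi, hj⟩ | ⟨hi, hj⟩⟩
      · have := h1 _ hj _ hi hlt
        simp only [Equiv.apply_symm_apply] at this
        exact absurd this (not_lt.mpr hij.le)
      · have := h2 _ hj _ hi hlt
        simp only [Equiv.apply_symm_apply] at this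
        exact absurd this (not_lt.mpr hij.le)
  refine card_bij (fun σ _ => List.ofFn σ.symm) ?_ ?_ ?_
  · intro σ hσ
    rw [mem_pairwiseOrderings, key]
    refine ⟨⟨List.nodup_ofFn.mpr σ.symm.injective, fun a => ?_⟩, (mem_filter.mp hσ).2⟩
    simp only [List.mem_ofFn, mem_univ, iff_true]
    exact σ.symm.surjective a
  · intro σ _ τ _ h
    have := List.ofFn_injective h
    exact Equiv.symm_bijective.injective (DFunLike.coe_injective this)
  · intro L hL
    obtain ⟨⟨hnd, hmem⟩, hp⟩ := mem_pairwiseOrderings.mp hL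
    have hlen : L.length = n := by
      rw [← List.toFinset_card_of_nodup hnd, show L.toFinset = univ by ext a; simp [hmem],
        card_univ, Fintype.card_fin]
    obtain ⟨f, rfl⟩ : ∃ f : Fin n → Fin n, List.ofFn f = L := by
      refine ⟨fun i => L.get (i.cast hlen.symm), List.ext_getElem (by simp [hlen]) ?_⟩
      simp
    have hf : Function.Injective f := List.nodup_ofFn.mp hnd
    let τ : Equiv.Perm (Fin n) := Equiv.ofBijective f (Finite.injective_iff_bijective.mp hf)
    have hτ : List.ofFn (τ.symm).symm = List.ofFn f := rfl
    exact ⟨τ.symm, mem_filter.mpr ⟨mem_univ _, (key τ.symm).mp (hτ ▸ hp)⟩, hτ⟩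

/-- Given two `k`-element subsets `X, Y` of `{1,…,n}` whose intersection has `j`
elements, with interlacing numbers `(l_0,…,l_j)` and `(m_0,…,m_j)` (where `l_r` counts
the elements of `X` lying strictly between the `r`-th and `(r+1)`-th common element,
i.e. the elements `x ∈ X \ Y` having exactly `r` common elements below them, and
similarly for `m_r` and `Y`), the number of permutations `σ ∈ S_n` for which both `X`
and `Y` are increasing subsequences equals `(n!/(2k−j)!)·∏_{r=0}^{j} C(l_r+m_r, l_r)`. -/
theorem count_perms_with_two_increasing_subsequences
    (n k j : ℕ) (hk1 : 1 ≤ k) (hkn : k ≤ n) (hjk : j ≤ k) (hj2k : 2*k - j ≤ n)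
    (X Y : Finset (Fin n)) (hX : X.card = k) (hY : Y.card = k) (hXY : (X ∩ Y).card = j)
    (l m : Fin (j+1) → ℕ)
    (hl : ∀ r : Fin (j+1), l r =
      (X.filter (fun x => x ∉ Y ∧ ((X ∩ Y).filter (fun z => z < x)).card = (r : ℕ))).card)
    (hm : ∀ r : Fin (j+1), m r =
      (Y.filter (fun y => y ∉ X ∧ ((X ∩ Y).filter (fun z => z < y)).card = (r : ℕ))).card) :
    (Finset.univ.filter (fun σ : Equiv.Perm (Fin n) =>
        (∀ x ∈ X, ∀ y ∈ X, x < y → σ x < σ y) ∧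
        (∀ x ∈ Y, ∀ y ∈ Y, x < y → σ x < σ y))).card * (2*k - j).factorial
      = n.factorial * ∏ r : Fin (j+1), (l r + m r).choose (l r) := by
  have hgX : ∀ r : Fin (j+1), gapCard X Y univ r = l r := by
    intro r
    rw [hl, gapCard]
    congr 1
    ext x
    simp [commonBelow, and_assoc]
  have hgY : ∀ r : Fin (j+1), gapCard Y X univ r = m r := by
    intro r
    rw [hm, gapCard]
    congr 1
    ext x
    simp [commonBelow, inter_comm Y X, and_assoc]
  have hU : (univ ∩ (X ∪ Y)).card = 2 * k - j := by
    have := card_union_add_card_inter X Y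
    rw [univ_inter]
    omega
  have h := card_pairwiseOrderings_mayPrecede X Y n univ (by simp)
    (fun z _ hz => absurd (mem_univ z) hz)
  rw [hU, gapProd, hXY, prod_range] at h
  simp_rw [hgX, hgY] at h
  rw [card_perm_increasing, h]
end

section
/- For each ρ > 0 there exists a constant C_ρ > 0 such that A(N,j) ≤ C_ρ^j · (j^{1/2}/Γ((j+1)/2)) · (2N)^{j/2} · C(2N,N)² for all integers j, N ≥ 1 with j/N ≤ ρ. Moreover, there exists a constant C > 0 such that A(k−j, j) ≤ C^j · (j^{1/2}/Γ((j+1)/2)) · (2k)^{j/2} · C(2k,k)² for all integers j, k ≥ 1 with j ≤ k. -/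
theorem sum_antidiagonalTuple_succ {M : Type*} [AddCommMonoid M] (k n : ℕ)
    (f : (Fin (k + 1) → ℕ) → M) :
    ∑ l ∈ Finset.Nat.antidiagonalTuple (k + 1) n, f l =
      ∑ p ∈ Finset.HasAntidiagonal.antidiagonal n, ∑ l ∈ Finset.Nat.antidiagonalTuple k p.2,
        f (Fin.cons p.1 l) := by
  rw [Finset.sum_sigma']
  refine Finset.sum_bij' (fun l _ => ⟨(l 0, ∑ i, Fin.tail l i), Fin.tail l⟩)
    (fun x _ => Fin.cons x.1.1 x.2) ?_ ?_ ?_ ?_ ?_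
  · intro l hl
    rw [Finset.Nat.mem_antidiagonalTuple, Fin.sum_univ_succ] at hl
    simp only [Finset.mem_sigma, Finset.HasAntidiagonal.mem_antidiagonal, Finset.Nat.mem_antidiagonalTuple]
    exact ⟨hl, trivial⟩
  · rintro ⟨p, l⟩ h
    simp only [Finset.mem_sigma, Finset.HasAntidiagonal.mem_antidiagonal,
      Finset.Nat.mem_antidiagonalTuple] at h ⊢
    rw [Fin.sum_univ_succ]
    simp [h.1, h.2]
  · intro l _
    simp
  · rintro ⟨⟨a, b⟩, l⟩ h
    simp only [Finset.mem_sigma, Finset.HasAntidiagonal.mem_antidiagonal,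
      Finset.Nat.mem_antidiagonalTuple] at h
    obtain ⟨-, rfl⟩ := h
    simp
  · intro l _
    simp

/-- The `(L, K)` refinement of `A`, with real values: the two tuples have `n` entries and
sum to `L` and `K`. -/
def tupleSum (n L K : ℕ) : ℝ :=
  ∑ l ∈ Finset.Nat.antidiagonalTuple n L, ∑ m ∈ Finset.Nat.antidiagonalTuple n K,
    ∏ r : Fin n, (((l r + m r).choose (l r) : ℕ) : ℝ) ^ 2

theorem tupleSum_succ (n L K : ℕ) :
    tupleSum (n + 1) L K =
      ∑ p ∈ Finset.HasAntidiagonal.antidiagonal L, ∑ q ∈ Finset.HasAntidiagonal.antidiagonal K,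
        (((p.1 + q.1).choose p.1 : ℕ) : ℝ) ^ 2 * tupleSum n p.2 q.2 := by
  unfold tupleSum
  rw [sum_antidiagonalTuple_succ]
  refine Finset.sum_congr rfl fun p _ => ?_
  simp_rw [sum_antidiagonalTuple_succ n K]
  rw [Finset.sum_comm]
  refine Finset.sum_congr rfl fun q _ => ?_
  simp_rw [Finset.mul_sum, Fin.prod_univ_succ]
  simp

theorem sum_choose_mul_choose_le (L K : ℕ) (g : ℕ → ℕ → ℝ) (hg : ∀ a b, 0 ≤ g a b) :
    ∑ p ∈ Finset.HasAntidiagonal.antidiagonal L, ∑ q ∈ Finset.HasAntidiagonal.antidiagonal K,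
      (((p.1 + q.1).choose p.1 : ℕ) : ℝ) * (((p.2 + q.2).choose p.2 : ℕ) : ℝ)
        * g (p.1 + q.1) (p.2 + q.2) ≤
      (((L + K).choose L : ℕ) : ℝ) * ∑ z ∈ Finset.HasAntidiagonal.antidiagonal (L + K), g z.1 z.2 := by
  rw [← Finset.sum_product', ← Finset.sum_fiberwise_of_maps_to
    (t := Finset.HasAntidiagonal.antidiagonal (L + K))
    (g := fun x : (ℕ × ℕ) × (ℕ × ℕ) => (x.1.1 + x.2.1, x.1.2 + x.2.2)), Finset.mul_sum]
  · refine Finset.sum_le_sum fun z hz => ?_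
    rw [Finset.HasAntidiagonal.mem_antidiagonal] at hz
    have hV : (((L + K).choose L : ℕ) : ℝ) =
        ∑ p ∈ Finset.HasAntidiagonal.antidiagonal L,
          ((z.1.choose p.1 : ℕ) : ℝ) * ((z.2.choose p.2 : ℕ) : ℝ) := by
      rw [← hz, Nat.add_choose_eq]
      push_cast
      rfl
    rw [hV, Finset.sum_mul]
    set S := {x ∈ Finset.HasAntidiagonal.antidiagonal L ×ˢ Finset.HasAntidiagonal.antidiagonal K |
      (x.1.1 + x.2.1, x.1.2 + x.2.2) = z} with hS
    have hinj : Set.InjOn Prod.fst (S : Set ((ℕ × ℕ) × (ℕ × ℕ))) := by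
      rintro ⟨⟨a, b⟩, c, d⟩ h ⟨⟨a', b'⟩, c', d'⟩ h' hab
      simp only [hS, Finset.coe_filter, Set.mem_ofPred_eq, Prod.ext_iff] at h h' hab ⊢
      obtain ⟨-, h1, h2⟩ := h
      obtain ⟨-, h3, h4⟩ := h'
      omega
    calc _ = ∑ x ∈ S, ((z.1.choose x.1.1 : ℕ) : ℝ) * ((z.2.choose x.1.2 : ℕ) : ℝ) * g z.1 z.2 := by
          refine Finset.sum_congr rfl fun x hx => ?_
          simp only [hS, Finset.mem_filter] at hx
          rw [← hx.2]
      _ = ∑ p ∈ S.image Prod.fst,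
            ((z.1.choose p.1 : ℕ) : ℝ) * ((z.2.choose p.2 : ℕ) : ℝ) * g z.1 z.2 := by
          rw [Finset.sum_image hinj]
      _ ≤ _ := by
          refine Finset.sum_le_sum_of_subset_of_nonneg ?_ fun p _ _ =>
            mul_nonneg (by positivity) (hg _ _)
          intro p hp
          obtain ⟨x, hx, rfl⟩ := Finset.mem_image.mp hp
          simp only [hS, Finset.mem_filter, Finset.mem_product] at hx
          exact hx.1.1
  · rintro ⟨⟨a, b⟩, c, d⟩ h
    simp only [Finset.mem_product, Finset.HasAntidiagonal.mem_antidiagonal] at h ⊢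
    omega

theorem multichoose_add (r s : ℝ) (n : ℕ) :
    Ring.multichoose (r + s) n =
      ∑ z ∈ Finset.HasAntidiagonal.antidiagonal n, Ring.multichoose r z.1 * Ring.multichoose s z.2 := by
  have key : ∀ (x : ℝ) (k : ℕ), Ring.multichoose x k = (-1) ^ k * Ring.choose (-x) k := by
    intro x k
    rw [Ring.choose_neg', Units.smul_def, zsmul_eq_mul, Int.coe_negOnePow_natCast]
    push_cast
    rw [← mul_assoc, ← mul_pow]
    simp
  rw [key, neg_add, Ring.add_choose_eq n (Commute.all _ _), Finset.mul_sum]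
  refine Finset.sum_congr rfl fun z hz => ?_
  rw [key, key, ← Finset.HasAntidiagonal.mem_antidiagonal.mp hz, pow_add]
  ring

theorem succ_mul_multichoose_succ (s : ℝ) (n : ℕ) :
    (n + 1) * Ring.multichoose s (n + 1) = (s + n) * Ring.multichoose s n := by
  have h1 := Ring.factorial_nsmul_multichoose_eq_ascPochhammer s (n + 1)
  have h0 := Ring.factorial_nsmul_multichoose_eq_ascPochhammer s n
  rw [Polynomial.ascPochhammer_smeval_eq_eval, nsmul_eq_mul] at h0 h1
  rw [ascPochhammer_succ_eval, ← h0, Nat.factorial_succ] at h1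
  push_cast at h1
  have : (n.factorial : ℝ) ≠ 0 := by positivity
  apply mul_left_cancel₀ this
  linear_combination h1

theorem multichoose_nonneg {s : ℝ} (hs : 0 ≤ s) (n : ℕ) : 0 ≤ Ring.multichoose s n := by
  induction n with
  | zero => simp
  | succ n ih =>
    have h := succ_mul_multichoose_succ s n
    have : 0 ≤ (n + 1) * Ring.multichoose s (n + 1) := by rw [h]; positivity
    exact nonneg_of_mul_nonneg_right this (by positivity)

theorem four_pow_mul_multichoose_half (n : ℕ) :
    4 ^ n * Ring.multichoose (1 / 2 : ℝ) n = n.centralBinom := by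
  induction n with
  | zero => simp
  | succ n ih =>
    have h := succ_mul_multichoose_succ (1 / 2 : ℝ) n
    have hc : ((n : ℝ) + 1) * (n + 1).centralBinom = 2 * (2 * n + 1) * n.centralBinom := by
      exact_mod_cast Nat.succ_mul_centralBinom_succ n
    have hn : (n : ℝ) + 1 ≠ 0 := by positivity
    apply mul_left_cancel₀ hn
    rw [hc, ← ih, pow_succ]
    linear_combination 4 ^ n * 4 * h

theorem Gamma_mul_factorial_mul_multichoose {s : ℝ} (hs : 0 < s) (n : ℕ) :
    Real.Gamma s * (n.factorial * Ring.multichoose s n) = Real.Gamma (n + s) := by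
  induction n with
  | zero => simp
  | succ n ih =>
    have h := succ_mul_multichoose_succ s n
    have e : ((n + 1 : ℕ) : ℝ) + s = (n + s) + 1 := by push_cast; ring
    rw [e, Real.Gamma_add_one (by positivity), ← ih, Nat.factorial_succ]
    push_cast
    linear_combination Real.Gamma s * n.factorial * h

theorem sq_centralBinom_le (n : ℕ) : (2 * n + 1) * n.centralBinom ^ 2 ≤ 16 ^ n := by
  induction n with
  | zero => simp
  | succ n ih =>
    have hc := Nat.succ_mul_centralBinom_succ n
    refine le_of_mul_le_mul_left (a := (n + 1) ^ 2) ?_ (by positivity)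
    calc (n + 1) ^ 2 * ((2 * (n + 1) + 1) * (n + 1).centralBinom ^ 2)
        = (2 * n + 3) * ((n + 1) * (n + 1).centralBinom) ^ 2 := by ring
      _ = 4 * (2 * n + 3) * (2 * n + 1) * ((2 * n + 1) * n.centralBinom ^ 2) := by rw [hc]; ring
      _ ≤ (16 * (n + 1) ^ 2) * 16 ^ n := Nat.mul_le_mul (by nlinarith) ih
      _ = _ := by ring

theorem sixteen_pow_le (n : ℕ) (hn : 1 ≤ n) : 16 ^ n ≤ 4 * n * n.centralBinom ^ 2 := by
  induction n, hn using Nat.le_induction with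
  | base => decide
  | succ n hn ih =>
    have hc := Nat.succ_mul_centralBinom_succ n
    refine le_of_mul_le_mul_left (a := (n + 1)) ?_ (by positivity)
    calc (n + 1) * 16 ^ (n + 1) = 16 * (n + 1) * 16 ^ n := by ring
      _ ≤ 16 * (n + 1) * (4 * n * n.centralBinom ^ 2) := Nat.mul_le_mul le_rfl ih
      _ = (16 * (4 * n * (n + 1))) * n.centralBinom ^ 2 := by ring
      _ ≤ (16 * (2 * n + 1) ^ 2) * n.centralBinom ^ 2 := Nat.mul_le_mul (by nlinarith) le_rfl
      _ = 4 * (2 * (2 * n + 1) * n.centralBinom) ^ 2 := by ring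
      _ = 4 * ((n + 1) * (n + 1).centralBinom) ^ 2 := by rw [hc]
      _ = _ := by ring

theorem succ_mul_sq_choose_le (n l : ℕ) : (n + 1) * n.choose l ^ 2 ≤ 4 ^ n := by
  have hl := Nat.choose_le_middle l n
  refine (Nat.mul_le_mul le_rfl (Nat.pow_le_pow_left hl 2)).trans ?_
  obtain ⟨m, rfl | rfl⟩ := n.even_or_odd'
  · have h := sq_centralBinom_le m
    rw [Nat.centralBinom_eq_two_mul_choose] at h
    rw [Nat.mul_div_cancel_left m two_pos, pow_mul]
    exact h
  · have h := sq_centralBinom_le (m + 1)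
    have hm : (2 * m + 1) / 2 = m := by omega
    have hc : (m + 1).centralBinom = 2 * (2 * m + 1).choose m := by
      rw [Nat.centralBinom_eq_two_mul_choose, show 2 * (m + 1) = 2 * m + 1 + 1 by ring,
        Nat.choose_succ_succ, Nat.choose_symm_half]
      ring
    have h16 : (16 : ℕ) ^ (m + 1) = 4 * 4 ^ (2 * m + 1) := by
      rw [pow_succ, pow_succ, pow_mul]
      norm_num
      ring
    rw [hc, h16] at h
    rw [hm]
    nlinarith

theorem choose_le_two_pow_mul_multichoose (n l : ℕ) :
    (n.choose l : ℝ) ≤ 2 * (2 ^ n * Ring.multichoose (1 / 2 : ℝ) n) := by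
  have key : 2 ^ n * n.choose l ≤ 2 * n.centralBinom := by
    rcases Nat.eq_zero_or_pos n with rfl | hn
    · cases l <;> simp
    have h1 := succ_mul_sq_choose_le n l
    have h2 := sixteen_pow_le n hn
    refine (Nat.pow_le_pow_iff_left two_ne_zero).mp ?_
    refine le_of_mul_le_mul_left (a := (n + 1) * 4 ^ n) ?_ (by positivity)
    calc (n + 1) * 4 ^ n * (2 ^ n * n.choose l) ^ 2
        = 16 ^ n * ((n + 1) * n.choose l ^ 2) := by
          have h16 : (16 : ℕ) ^ n = 4 ^ n * (2 ^ n) ^ 2 := by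
            rw [← pow_mul, mul_comm n 2, pow_mul, ← mul_pow]
            norm_num
          rw [h16]
          ring
      _ ≤ (4 * n * n.centralBinom ^ 2) * 4 ^ n := Nat.mul_le_mul h2 h1
      _ ≤ (4 * (n + 1) * n.centralBinom ^ 2) * 4 ^ n := by gcongr; omega
      _ = _ := by ring
  have key' : (2 : ℝ) ^ n * n.choose l ≤ 2 * n.centralBinom := by exact_mod_cast key
  rw [← four_pow_mul_multichoose_half] at key'
  have h4 : (4 : ℝ) ^ n = 2 ^ n * 2 ^ n := by rw [← mul_pow]; norm_num
  rw [h4] at key'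
  refine le_of_mul_le_mul_left (a := (2 : ℝ) ^ n) ?_ (by positivity)
  linarith

theorem tupleSum_succ_le (n L K : ℕ) :
    tupleSum (n + 1) L K ≤ 2 ^ (n + 1) * (((L + K).choose L : ℕ) : ℝ) * 2 ^ (L + K) *
      Ring.multichoose (((n : ℝ) + 1) / 2) (L + K) := by
  induction n generalizing L K with
  | zero =>
    have h := choose_le_two_pow_mul_multichoose (L + K) L
    have h0 : (0 : ℝ) ≤ ((L + K).choose L : ℕ) := by positivity
    have e : tupleSum (0 + 1) L K = (((L + K).choose L : ℕ) : ℝ) ^ 2 := by simp [tupleSum]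
    rw [e, Nat.cast_zero, zero_add, zero_add]
    nlinarith [mul_le_mul_of_nonneg_left h h0]
  | succ n ih =>
    set s : ℝ := ((n : ℝ) + 1) / 2 with hs
    have hs0 : 0 ≤ s := by positivity
    have e : (((n + 1 : ℕ) : ℝ) + 1) / 2 = 1 / 2 + s := by rw [hs]; push_cast; ring
    rw [tupleSum_succ, e, multichoose_add]
    set g : ℕ → ℕ → ℝ := fun a b => 2 ^ (n + 2) * 2 ^ (a + b) *
      (Ring.multichoose (1 / 2 : ℝ) a * Ring.multichoose s b) with hg
    have hg0 : ∀ a b, 0 ≤ g a b := fun a b =>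
      mul_nonneg (by positivity) (mul_nonneg (multichoose_nonneg (by norm_num) a)
        (multichoose_nonneg hs0 b))
    calc _ ≤ ∑ p ∈ Finset.HasAntidiagonal.antidiagonal L, ∑ q ∈ Finset.HasAntidiagonal.antidiagonal K,
          (((p.1 + q.1).choose p.1 : ℕ) : ℝ) * (((p.2 + q.2).choose p.2 : ℕ) : ℝ) *
            g (p.1 + q.1) (p.2 + q.2) := by
          refine Finset.sum_le_sum fun p _ => Finset.sum_le_sum fun q _ => ?_
          have h1 := choose_le_two_pow_mul_multichoose (p.1 + q.1) p.1
          have h2 := ih p.2 q.2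
          have h3 : 0 ≤ tupleSum (n + 1) p.2 q.2 := by unfold tupleSum; positivity
          have hm := multichoose_nonneg (s := 1 / 2) (by norm_num) (p.1 + q.1)
          have hm' := multichoose_nonneg hs0 (p.2 + q.2)
          calc _ = (((p.1 + q.1).choose p.1 : ℕ) : ℝ) *
                (((p.1 + q.1).choose p.1 : ℕ) : ℝ) * tupleSum (n + 1) p.2 q.2 := by ring
            _ ≤ (((p.1 + q.1).choose p.1 : ℕ) : ℝ) *
                (2 * (2 ^ (p.1 + q.1) * Ring.multichoose (1 / 2 : ℝ) (p.1 + q.1))) *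
                (2 ^ (n + 1) * (((p.2 + q.2).choose p.2 : ℕ) : ℝ) * 2 ^ (p.2 + q.2) *
                  Ring.multichoose s (p.2 + q.2)) := by
                gcongr
            _ = _ := by rw [hg]; ring
      _ ≤ _ := sum_choose_mul_choose_le L K g hg0
      _ = _ := by
          rw [Finset.mul_sum, Finset.mul_sum]
          refine Finset.sum_congr rfl fun z hz => ?_
          rw [hg, ← Finset.HasAntidiagonal.mem_antidiagonal.mp hz]
          ring

theorem Gamma_add_half_le {x : ℝ} (hx : 0 < x) :
    Real.Gamma (x + 1 / 2) ≤ Real.sqrt x * Real.Gamma x := by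
  have h := Real.Gamma_mul_add_mul_le_rpow_Gamma_mul_rpow_Gamma (s := x) (t := x + 1)
    (a := 1 / 2) (b := 1 / 2) hx (by linarith) (by norm_num) (by norm_num) (by norm_num)
  have hG := Real.Gamma_pos_of_pos hx
  rw [Real.Gamma_add_one hx.ne', ← Real.sqrt_eq_rpow, ← Real.sqrt_eq_rpow,
    Real.sqrt_mul hx.le] at h
  calc _ = Real.Gamma (1 / 2 * x + 1 / 2 * (x + 1)) := by congr 1; ring
    _ ≤ _ := h
    _ = Real.sqrt x * (Real.sqrt (Real.Gamma x) * Real.sqrt (Real.Gamma x)) := by ring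
    _ = _ := by rw [Real.mul_self_sqrt hG.le]

theorem Gamma_add_div_two_le (M i : ℕ) (T : ℝ) (hT : M + ((i : ℝ) + 1) / 2 ≤ T) :
    Real.Gamma (M + ((i : ℝ) + 2) / 2) ≤ Real.sqrt T ^ i * M.factorial := by
  induction i with
  | zero => simp [Real.Gamma_nat_eq_factorial]
  | succ i ih =>
    push_cast at hT
    have ih := ih (by linarith)
    have hx : (0 : ℝ) < M + ((i : ℝ) + 2) / 2 := by positivity
    calc _ = Real.Gamma (M + ((i : ℝ) + 2) / 2 + 1 / 2) := by congr 1; push_cast; ring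
      _ ≤ Real.sqrt (M + ((i : ℝ) + 2) / 2) * Real.Gamma (M + ((i : ℝ) + 2) / 2) :=
          Gamma_add_half_le hx
      _ ≤ Real.sqrt T * (Real.sqrt T ^ i * M.factorial) := by
          gcongr
          linarith
      _ = _ := by ring

theorem A_le_of_le (N j k : ℕ) (D : ℝ) (hD : 1 ≤ D) (hj : 1 ≤ j) (hk : 1 ≤ k) (hNk : N ≤ k)
    (hT : 2 * N + (j : ℝ) / 2 ≤ D * (2 * k)) :
    (A N j : ℝ) ≤ (8 * D) ^ j * (Real.sqrt j / Real.Gamma (((j : ℝ) + 1) / 2))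
        * (2 * (k : ℝ)) ^ ((j : ℝ) / 2) * (((2 * k).choose k : ℝ)) ^ 2 := by
  obtain ⟨i, rfl⟩ : ∃ i, j = i + 1 := ⟨j - 1, by omega⟩
  have hA : (A N (i + 1) : ℝ) = tupleSum (i + 1 + 1) N N := by
    unfold A tupleSum
    push_cast
    rfl
  set G := Real.Gamma ((((i + 1 : ℕ) : ℝ) + 1) / 2) with hG
  have hG0 : 0 < G := Real.Gamma_pos_of_pos (by positivity)
  have hb := tupleSum_succ_le (i + 1) N N
  rw [← hA] at hb
  have hm : Ring.multichoose ((((i + 1 : ℕ) : ℝ) + 1) / 2) (N + N) ≤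
      Real.sqrt (D * (2 * k)) ^ i / G := by
    have h1 := Gamma_mul_factorial_mul_multichoose
      (s := (((i + 1 : ℕ) : ℝ) + 1) / 2) (by positivity) (N + N)
    have h2 := Gamma_add_div_two_le (N + N) i (D * (2 * k)) (by push_cast at hT ⊢; linarith)
    rw [show (i : ℝ) + 2 = ((i + 1 : ℕ) : ℝ) + 1 by push_cast; ring, ← h1, ← hG] at h2
    rw [le_div_iff₀ hG0]
    have hf : (0 : ℝ) < (N + N).factorial := by positivity
    refine le_of_mul_le_mul_right ?_ hf
    linarith
  have hc : (((N + N).choose N : ℕ) : ℝ) ≤ (2 * k).choose k := by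
    rw [← two_mul]
    exact_mod_cast Nat.centralBinom_strictMono.monotone hNk
  have h4 : (2 : ℝ) ^ (N + N) ≤ 2 * Real.sqrt k * (2 * k).choose k := by
    have h16 : (16 : ℝ) ^ k ≤ 4 * k * ((2 * k).choose k : ℝ) ^ 2 := by
      exact_mod_cast sixteen_pow_le k hk
    refine (pow_le_pow_right₀ one_le_two (by omega : N + N ≤ 2 * k)).trans ?_
    refine le_of_sq_le_sq ?_ (by positivity)
    rw [mul_pow, mul_pow, Real.sq_sqrt (by positivity), ← pow_mul, mul_comm (2 * k) 2,
      ← mul_assoc, pow_mul]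
    norm_num
    exact h16
  have hk1 : Real.sqrt k ≤ Real.sqrt (D * (2 * k)) := by
    apply Real.sqrt_le_sqrt
    have : (0 : ℝ) ≤ k := by positivity
    nlinarith
  have hpow : (2 * (k : ℝ)) ^ (((i + 1 : ℕ) : ℝ) / 2) = Real.sqrt (2 * k) ^ (i + 1) := by
    rw [Real.sqrt_eq_rpow, ← Real.rpow_natCast, ← Real.rpow_mul (by positivity)]
    congr 1
    ring
  have hsD : Real.sqrt D ≤ D := Real.sqrt_le_iff.mpr ⟨by linarith, by nlinarith⟩
  have hj1 : 1 ≤ Real.sqrt ((i + 1 : ℕ) : ℝ) := Real.one_le_sqrt.mpr (by exact_mod_cast hj)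
  have h8 : (2 : ℝ) ^ (i + 1 + 1) * 2 ≤ 8 ^ (i + 1) := by
    have h1 : (1 : ℝ) ≤ 4 ^ i := one_le_pow₀ (by norm_num)
    have h2 : (8 : ℝ) ^ i = 2 ^ i * 4 ^ i := by rw [← mul_pow]; norm_num
    have h3 : (0 : ℝ) < 2 ^ i := by positivity
    rw [pow_succ, pow_succ, pow_succ, h2]
    nlinarith
  set c : ℝ := (((2 * k).choose k : ℕ) : ℝ)
  have hc0 : 0 ≤ c := by positivity
  rw [hpow]
  calc (A N (i + 1) : ℝ)
      ≤ 2 ^ (i + 1 + 1) * (((N + N).choose N : ℕ) : ℝ) * 2 ^ (N + N) *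
        Ring.multichoose ((((i + 1 : ℕ) : ℝ) + 1) / 2) (N + N) := hb
    _ ≤ 2 ^ (i + 1 + 1) * c * (2 * Real.sqrt k * c) * (Real.sqrt (D * (2 * k)) ^ i / G) := by
        gcongr
        exact multichoose_nonneg (by positivity) _
    _ = 2 ^ (i + 1 + 1) * 2 * (1 / G) * (Real.sqrt (D * (2 * k)) ^ i * Real.sqrt k) * c ^ 2 := by
        ring
    _ ≤ 8 ^ (i + 1) * (Real.sqrt ((i + 1 : ℕ) : ℝ) / G) *
        (Real.sqrt (D * (2 * k)) ^ i * Real.sqrt (D * (2 * k))) * c ^ 2 := by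
        gcongr
    _ = 8 ^ (i + 1) * (Real.sqrt ((i + 1 : ℕ) : ℝ) / G) *
        (Real.sqrt D ^ (i + 1) * Real.sqrt (2 * k) ^ (i + 1)) * c ^ 2 := by
        rw [← pow_succ, Real.sqrt_mul (by linarith), mul_pow]
    _ ≤ 8 ^ (i + 1) * (Real.sqrt ((i + 1 : ℕ) : ℝ) / G) *
        (D ^ (i + 1) * Real.sqrt (2 * k) ^ (i + 1)) * c ^ 2 := by
        gcongr
    _ = _ := by
        rw [mul_pow]
        ring

/-- For each `ρ > 0` there is `C_ρ > 0` with
`A(N,j) ≤ C_ρ^j·(j^{1/2}/Γ((j+1)/2))·(2N)^{j/2}·C(2N,N)²` whenever `j,N ≥ 1`, `j/N ≤ ρ`;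
moreover there is `C > 0` with
`A(k−j,j) ≤ C^j·(j^{1/2}/Γ((j+1)/2))·(2k)^{j/2}·C(2k,k)²` for all `1 ≤ j ≤ k`. -/
theorem A_upper_bounds :
    (∀ ρ : ℝ, 0 < ρ → ∃ C : ℝ, 0 < C ∧ ∀ j N : ℕ, 1 ≤ j → 1 ≤ N → (j : ℝ) / (N : ℝ) ≤ ρ →
      (A N j : ℝ) ≤ C ^ j * (Real.sqrt j / Real.Gamma (((j : ℝ) + 1) / 2))
        * (2 * (N : ℝ)) ^ ((j : ℝ) / 2) * (((2*N).choose N : ℝ))^2)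
    ∧ (∃ C : ℝ, 0 < C ∧ ∀ j k : ℕ, 1 ≤ j → j ≤ k →
      (A (k - j) j : ℝ) ≤ C ^ j * (Real.sqrt j / Real.Gamma (((j : ℝ) + 1) / 2))
        * (2 * (k : ℝ)) ^ ((j : ℝ) / 2) * (((2*k).choose k : ℝ))^2) := by
  constructor
  · intro ρ hρ
    refine ⟨8 * (1 + ρ), by positivity, fun j N hj hN h => ?_⟩
    have hN' : (0 : ℝ) < N := by exact_mod_cast hN
    rw [div_le_iff₀ hN'] at h
    exact A_le_of_le N j N (1 + ρ) (by linarith) hj hN le_rfl (by nlinarith)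
  · refine ⟨8 * 1, by norm_num, fun j k hj hjk => ?_⟩
    refine A_le_of_le (k - j) j k 1 le_rfl hj (hj.trans hjk) (Nat.sub_le k j) ?_
    rw [Nat.cast_sub hjk]
    have : (0 : ℝ) ≤ j := by positivity
    linarith
end

section
/- There exists a constant C > 0 such that for all integers k ≥ 2, A(k−1, 1) ≥ C·(2k−2)^{1/2}·C(2k−2, k−1)². -/
open Finset in
/-- The Chu–Vandermonde identity as a sum over a range. -/
lemma sum_range_choose_mul_choose (s t N : ℕ) :
    ∑ l ∈ range (N + 1), (s.choose l : ℝ) * (t.choose (N - l) : ℝ) = ((s + t).choose N : ℝ) := by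
  rw [Nat.add_choose_eq,
    Finset.Nat.sum_antidiagonal_eq_sum_range_succ (fun i j => s.choose i * t.choose j)]
  push_cast
  rfl

lemma sub_mul_cast_choose_succ (n k : ℕ) :
    ((n : ℝ) + 1 - k) * ((n + 1).choose k : ℝ) = (n + 1) * (n.choose k : ℝ) := by
  rcases le_or_gt k (n + 1) with h | h
  · have h1 := Nat.choose_mul_succ_eq n k
    have h2 : (n.choose k : ℝ) * (n + 1) = ((n + 1).choose k : ℝ) * ((n + 1 - k : ℕ) : ℝ) := by
      exact_mod_cast h1
    rw [Nat.cast_sub h] at h2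
    push_cast at h2
    linarith
  · rw [Nat.choose_eq_zero_of_lt h, Nat.choose_eq_zero_of_lt (by omega)]
    simp

lemma mul_sub_mul_cast_choose (s l : ℕ) :
    ((l : ℝ) + 1) * ((s : ℝ) + 1 - l) * ((s + 2).choose (l + 1) : ℝ)
      = (s + 2) * (s + 1) * (s.choose l : ℝ) := by
  have h1 := sub_mul_cast_choose_succ s l
  have h2 : ((s : ℝ) + 2) * ((s + 1).choose l : ℝ) = ((s + 2).choose (l + 1) : ℝ) * (l + 1) := by
    have := Nat.add_one_mul_choose_eq (s + 1) l
    have h3 : (((s + 1 + 1) * (s + 1).choose l : ℕ) : ℝ)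
        = (((s + 1 + 1).choose (l + 1) * (l + 1) : ℕ) : ℝ) := by rw [this]
    push_cast at h3
    linarith
  linear_combination ((s : ℝ) + 2) * h1 - ((s : ℝ) + 1 - l) * h2

open Finset in
/-- A mixed factorial moment of the hypergeometric weights. -/
lemma sum_mul_sub_mul_choose (s t N : ℕ) (h : s + t = 2 * (N + 1)) :
    ∑ l ∈ range (N + 2), (l : ℝ) * ((s : ℝ) - l) * ((s.choose l : ℝ) * (t.choose (N + 1 - l) : ℝ))
      = s * (s - 1) * ((2 * N).choose N : ℝ) := by
  rcases s with _ | _ | s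
  · simp only [Nat.cast_zero, zero_mul]
    refine sum_eq_zero fun l _ => ?_
    rcases l with _ | l <;> simp
  · simp only [zero_add, Nat.cast_one, sub_self, mul_zero, zero_mul]
    refine sum_eq_zero fun l _ => ?_
    rcases l with _ | _ | l
    · simp
    · simp
    · rw [Nat.choose_eq_zero_of_lt (by omega)]
      simp
  · have hst : s + t = 2 * N := by omega
    rw [sum_range_succ', ← hst, ← sum_range_choose_mul_choose s t N, mul_sum]
    simp only [Nat.cast_zero, zero_mul, add_zero]
    refine sum_congr rfl fun l _ => ?_
    rw [Nat.add_sub_add_right]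
    push_cast
    linear_combination (t.choose (N - l) : ℝ) * mul_sub_mul_cast_choose s l

open Finset in
/-- The variance bound for the hypergeometric weights. -/
lemma sum_sq_mul_choose_le (s t N : ℕ) (hN : 1 ≤ N) (h : s + t = 2 * N) :
    ∑ l ∈ range (N + 1), (2 * (l : ℝ) - s) ^ 2 * ((s.choose l : ℝ) * (t.choose (N - l) : ℝ))
      ≤ N * ((2 * N).choose N : ℝ) := by
  obtain ⟨N, rfl⟩ : ∃ n, N = n + 1 := ⟨N - 1, by omega⟩
  have h1 := sum_mul_sub_mul_choose s t N h
  have h0 := sum_range_choose_mul_choose s t (N + 1)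
  rw [h] at h0
  have h2 : ∑ l ∈ range (N + 1 + 1),
      (2 * (l : ℝ) - s) ^ 2 * ((s.choose l : ℝ) * (t.choose (N + 1 - l) : ℝ))
      = s ^ 2 * ((2 * (N + 1)).choose (N + 1) : ℝ) - 4 * (s * (s - 1) * ((2 * N).choose N : ℝ)) := by
    rw [← h0, ← h1, mul_sum, mul_sum, ← sum_sub_distrib]
    refine sum_congr rfl fun l _ => ?_
    ring
  rw [h2]
  have h3 : ((N : ℝ) + 1) * ((2 * (N + 1)).choose (N + 1) : ℝ)
      = 2 * (2 * N + 1) * ((2 * N).choose N : ℝ) := by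
    exact_mod_cast Nat.succ_mul_centralBinom_succ N
  have hP : (0 : ℝ) ≤ ((2 * (N + 1)).choose (N + 1) : ℝ) := Nat.cast_nonneg _
  set P : ℝ := ((2 * (N + 1)).choose (N + 1) : ℝ)
  set Q : ℝ := ((2 * N).choose N : ℝ)
  have hn : (0 : ℝ) ≤ N := Nat.cast_nonneg _
  have hpos : (0 : ℝ) < 2 * N + 1 := by positivity
  push_cast
  refine le_of_mul_le_mul_left ?_ hpos
  have h4 : (2 * (N : ℝ) + 1) * (s ^ 2 * P - 4 * (s * (s - 1) * Q))
      = P * (s * (2 * (N + 1) - s)) := by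
    linear_combination 2 * (s : ℝ) * (s - 1) * h3
  rw [h4]
  have h5 : (s : ℝ) * (2 * (N + 1) - s) ≤ (2 * N + 1) * (N + 1) := by
    nlinarith [sq_nonneg ((s : ℝ) - (N + 1)), mul_nonneg hn hn]
  nlinarith [mul_le_mul_of_nonneg_left h5 hP]

open Finset in
lemma card_filter_sq_le (s N M : ℕ) :
    ((#{l ∈ range M | (2 * ((l : ℕ) : ℝ) - s) ^ 2 ≤ 2 * N} : ℕ) : ℝ) ≤ √(2 * N : ℕ) + 2 := by
  have hsub : {l ∈ range M | (2 * ((l : ℕ) : ℝ) - s) ^ 2 ≤ 2 * N}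
      ⊆ Icc ((s - Nat.sqrt (2 * N)) / 2) ((s + Nat.sqrt (2 * N)) / 2) := by
    intro l hl
    have h1 : (2 * (l : ℤ) - s) ^ 2 ≤ 2 * N := by exact_mod_cast (mem_filter.1 hl).2
    have h2 : (2 * (l : ℤ) - s).natAbs ≤ Nat.sqrt (2 * N) := by
      rw [Nat.le_sqrt']
      zify
      rw [sq_abs]
      exact h1
    rw [mem_Icc]
    omega
  have h1 : #{l ∈ range M | (2 * ((l : ℕ) : ℝ) - s) ^ 2 ≤ 2 * N} ≤ Nat.sqrt (2 * N) + 2 := by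
    refine (card_le_card hsub).trans ?_
    rw [Nat.card_Icc]
    omega
  have h2 : ((Nat.sqrt (2 * N) : ℕ) : ℝ) ≤ √(2 * N : ℕ) := Real.nat_sqrt_le_real_sqrt
  have h3 : ((#{l ∈ range M | (2 * ((l : ℕ) : ℝ) - s) ^ 2 ≤ 2 * N} : ℕ) : ℝ)
      ≤ (Nat.sqrt (2 * N) : ℝ) + 2 := by exact_mod_cast h1
  linarith

open Finset in
/-- Hypergeometric weights concentrate on `O(√N)` values, so their squares have a large sum. -/
lemma sq_choose_le_sum_sq (s t N : ℕ) (hN : 1 ≤ N) (h : s + t = 2 * N) :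
    ((2 * N).choose N : ℝ) ^ 2
      ≤ 12 * √(2 * N : ℕ) *
        ∑ l ∈ range (N + 1), ((s.choose l : ℝ) * (t.choose (N - l) : ℝ)) ^ 2 := by
  have hsum := sum_range_choose_mul_choose s t N
  have hvar := sum_sq_mul_choose_le s t N hN h
  have hcard := card_filter_sq_le s N (N + 1)
  rw [h] at hsum
  set P : ℝ := ((2 * N).choose N : ℝ)
  have hP : 0 ≤ P := Nat.cast_nonneg _
  set p : ℕ → ℝ := fun l => (s.choose l : ℝ) * (t.choose (N - l) : ℝ)
  have hp0 : ∀ l, 0 ≤ p l := fun l => by positivity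
  change ∑ l ∈ range (N + 1), p l = P at hsum
  change ∑ l ∈ range (N + 1), (2 * (l : ℝ) - s) ^ 2 * p l ≤ N * P at hvar
  change P ^ 2 ≤ 12 * √(2 * N : ℕ) * ∑ l ∈ range (N + 1), p l ^ 2
  have hNpos : (1 : ℝ) ≤ N := by exact_mod_cast hN
  set S := {l ∈ range (N + 1) | (2 * ((l : ℕ) : ℝ) - s) ^ 2 ≤ 2 * N}
  have hsplit := sum_filter_add_sum_filter_not (range (N + 1))
    (fun l : ℕ => (2 * (l : ℝ) - s) ^ 2 ≤ 2 * N) p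
  have htail : 2 * N * ∑ l ∈ range (N + 1) with ¬ (2 * ((l : ℕ) : ℝ) - s) ^ 2 ≤ 2 * N, p l ≤ N * P := by
    refine le_trans ?_ hvar
    rw [mul_sum]
    refine (sum_le_sum fun l hl => ?_).trans
      (sum_le_sum_of_subset_of_nonneg (filter_subset _ _) fun l _ _ =>
        mul_nonneg (sq_nonneg _) (hp0 l))
    exact mul_le_mul_of_nonneg_right (not_le.1 (mem_filter.1 hl).2).le (hp0 l)
  have hhalf : P / 2 ≤ ∑ l ∈ S, p l := by
    have : 2 * ∑ l ∈ range (N + 1) with ¬ (2 * ((l : ℕ) : ℝ) - s) ^ 2 ≤ 2 * N, p l ≤ P := by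
      refine le_of_mul_le_mul_left ?_ (by linarith : (0 : ℝ) < N)
      linarith
    linarith
  have hCS : (∑ l ∈ S, p l) ^ 2 ≤ (#S : ℝ) * ∑ l ∈ S, p l ^ 2 := sq_sum_le_card_mul_sum_sq
  have hle : ∑ l ∈ S, p l ^ 2 ≤ ∑ l ∈ range (N + 1), p l ^ 2 :=
    sum_le_sum_of_subset_of_nonneg (filter_subset _ _) fun l _ _ => sq_nonneg _
  have hsqrt : 1 ≤ √(2 * N : ℕ) := by
    rw [Real.one_le_sqrt]
    push_cast
    linarith
  have hsq : (P / 2) ^ 2 ≤ (∑ l ∈ S, p l) ^ 2 := pow_le_pow_left₀ (by linarith) hhalf 2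
  have hfin : (#S : ℝ) * ∑ l ∈ S, p l ^ 2
      ≤ (3 * √(2 * N : ℕ)) * ∑ l ∈ range (N + 1), p l ^ 2 :=
    mul_le_mul (by linarith) hle (sum_nonneg fun l _ => sq_nonneg _) (by linarith)
  linarith

open Finset in
lemma A_one_eq (N : ℕ) :
    A N 1 = ∑ l ∈ range (N + 1), ∑ m ∈ range (N + 1),
      ((l + m).choose l * (N - l + (N - m)).choose (N - l)) ^ 2 := by
  change ∑ l ∈ Finset.Nat.antidiagonalTuple 2 N, ∑ m ∈ Finset.Nat.antidiagonalTuple 2 N,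
    ∏ r : Fin 2, ((l r + m r).choose (l r)) ^ 2 = _
  simp only [Finset.Nat.antidiagonalTuple_two, sum_map, Fin.prod_univ_two, mul_pow,
    Finset.Nat.sum_antidiagonal_eq_sum_range_succ_mk]
  rfl

open Finset in
/-- The terms of `A N 1` with `l_0 + m_0 = s ≤ N`, grouped by `s`. -/
lemma sum_sum_sq_le_A_one (N : ℕ) :
    ∑ s ∈ range (N + 1), ∑ l ∈ range (N + 1),
      ((s.choose l : ℝ) * ((2 * N - s).choose (N - l) : ℝ)) ^ 2 ≤ (A N 1 : ℝ) := by
  rw [A_one_eq, sum_comm]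
  push_cast
  refine sum_le_sum fun l hl => ?_
  have hl' : l ≤ N := Nat.lt_succ_iff.1 (mem_range.1 hl)
  rw [show range (N + 1) = range (l + (N + 1 - l)) by congr 1; omega, sum_range_add]
  rw [sum_eq_zero (s := range l), zero_add]
  · refine (sum_le_sum fun m hm => ?_).trans
      (sum_le_sum_of_subset_of_nonneg (range_subset_range.2 (Nat.le_add_left _ l))
        fun m _ _ => sq_nonneg _)
    have : m < N + 1 - l := mem_range.1 hm
    rw [show 2 * N - (l + m) = N - l + (N - m) by omega]
  · intro s hs
    rw [Nat.choose_eq_zero_of_lt (mem_range.1 hs)]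
    simp

/-- There is a constant `C > 0` with `A(k−1,1) ≥ C·(2k−2)^{1/2}·C(2k−2,k−1)²`
for all `k ≥ 2`. -/
theorem A_lower_bound :
    ∃ C : ℝ, 0 < C ∧ ∀ k : ℕ, 2 ≤ k →
      C * Real.sqrt ((2*k - 2 : ℕ)) * (((2*k - 2).choose (k - 1) : ℝ))^2
        ≤ (A (k - 1) 1 : ℝ) := by
  refine ⟨1 / 24, by norm_num, fun k hk => ?_⟩
  obtain ⟨N, rfl⟩ : ∃ n, k = n + 1 := ⟨k - 1, by omega⟩
  have hN : 1 ≤ N := by omega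
  rw [show 2 * (N + 1) - 2 = 2 * N by omega, Nat.add_sub_cancel]
  have hsq : √(2 * N : ℕ) * √(2 * N : ℕ) = 2 * N := by
    rw [Real.mul_self_sqrt (Nat.cast_nonneg _)]
    push_cast
    rfl
  have hpos : 0 < √(2 * N : ℕ) := Real.sqrt_pos.2 (by exact_mod_cast (by omega : 0 < 2 * N))
  have hsum := Finset.card_nsmul_le_sum (Finset.range (N + 1))
    (fun s => 12 * √(2 * N : ℕ) * ∑ l ∈ Finset.range (N + 1),
      ((s.choose l : ℝ) * ((2 * N - s).choose (N - l) : ℝ)) ^ 2)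
    (((2 * N).choose N : ℝ) ^ 2) (fun s hs => sq_choose_le_sum_sq s (2 * N - s) N hN (by
      have := Finset.mem_range.1 hs
      omega))
  rw [← Finset.mul_sum, Finset.card_range, nsmul_eq_mul] at hsum
  have hA := mul_le_mul_of_nonneg_left (sum_sum_sq_le_A_one N)
    (by positivity : 0 ≤ 12 * √(2 * N : ℕ))
  refine le_of_mul_le_mul_left ?_ (by positivity : 0 < 12 * √(2 * N : ℕ))
  refine le_trans ?_ (hsum.trans hA)
  have : 12 * √(2 * N : ℕ) * (1 / 24 * √(2 * N : ℕ) * ((2 * N).choose N : ℝ) ^ 2)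
      = N * ((2 * N).choose N : ℝ) ^ 2 := by
    linear_combination (1 / 2) * ((2 * N).choose N : ℝ) ^ 2 * hsq
  rw [this]
  push_cast
  nlinarith [sq_nonneg ((2 * N).choose N : ℝ)]
end

section
/- For all integers N ≥ 1 and j ≥ 1: ∑ over all (j+1)-tuples (s_0, s_1, …, s_j) of nonnegative integers with s_0 + … + s_j = 2N, of the number of paths ω : {0,1,…,2N} → ℤ² with ω(0) = ω(2N) = (0,0), each increment ω(m+1) − ω(m) ∈ {(1,0), (−1,0), (0,1), (0,−1)}, and second coordinate of ω equal to 0 at each of the times t_0, t_1, …, t_{j−1} (where t_r = s_0 + … + s_r), equals A(N,j). Equivalently, A(N,j)/C(2N,N)² is the sum over all such tuples (s_0,…,s_j) of the probability that the simple symmetric two-dimensional random walk, started at the origin and conditioned to return to the origin at step 2N, has vanishing second coordinate at times t_0, …, t_{j−1}. -/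
/-- The four unit steps of the simple symmetric random walk on `ℤ²`. -/
def step : Fin 4 → ℤ × ℤ := ![(1, 0), (-1, 0), (0, 1), (0, -1)]

/-- The position at time `t` of the path on `ℤ²` started at the origin with step
sequence `ε` (partial sum of the first `t` steps). -/
def pos {n : ℕ} (ε : Fin n → Fin 4) (t : ℕ) : ℤ × ℤ :=
  ∑ i : Fin n, if (i : ℕ) < t then step (ε i) else 0

/-- The number of steps in `g` along which the coordinate `x + y` increases. -/
def sumUps {n : ℕ} (g : Fin n → Fin 4) : ℕ :=
  (Finset.univ.filter fun i => g i = 0 ∨ g i = 2).card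

/-- The number of steps in `g` along which the coordinate `x - y` increases. -/
def diffUps {n : ℕ} (g : Fin n → Fin 4) : ℕ :=
  (Finset.univ.filter fun i => g i = 0 ∨ g i = 3).card

theorem sum_step_snd {n : ℕ} (g : Fin n → Fin 4) :
    (∑ i, step (g i)).2 = (sumUps g : ℤ) - diffUps g := by
  rw [Prod.snd_sum, sumUps, diffUps, Finset.card_filter, Finset.card_filter]
  push_cast
  rw [← Finset.sum_sub_distrib]
  refine Finset.sum_congr rfl fun i _ => ?_
  generalize g i = a
  fin_cases a <;> simp [step]

theorem sum_step_fst {n : ℕ} (g : Fin n → Fin 4) :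
    (∑ i, step (g i)).1 = (sumUps g : ℤ) + diffUps g - n := by
  have hn : (n : ℤ) = ∑ _i : Fin n, 1 := by simp
  rw [Prod.fst_sum, sumUps, diffUps, Finset.card_filter, Finset.card_filter, hn]
  push_cast
  rw [← Finset.sum_add_distrib, ← Finset.sum_sub_distrib]
  refine Finset.sum_congr rfl fun i _ => ?_
  generalize g i = a
  fin_cases a <;> simp [step]

/-- The coordinates `x + y` and `x - y` of a planar walk are two independent simple walks, so
prescribing the number of up-steps of both gives a squared binomial coefficient. -/
theorem card_sumUps_eq_and_diffUps_eq (n l : ℕ) :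
    (Finset.univ.filter fun g : Fin n → Fin 4 => sumUps g = l ∧ diffUps g = l).card
      = (n.choose l) ^ 2 := by
  have hcard : (Finset.powersetCard l (Finset.univ : Finset (Fin n)) ×ˢ
      Finset.powersetCard l (Finset.univ : Finset (Fin n))).card = (n.choose l) ^ 2 := by
    simp [sq]
  rw [← hcard]
  refine Finset.card_bij'
    (fun g _ => (Finset.univ.filter fun i => g i = 0 ∨ g i = 2,
      Finset.univ.filter fun i => g i = 0 ∨ g i = 3))
    (fun p _ i => if i ∈ p.1 then (if i ∈ p.2 then 0 else 2) else (if i ∈ p.2 then 3 else 1))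
    ?_ ?_ ?_ ?_
  · intro g hg
    rw [Finset.mem_filter] at hg
    simpa [Finset.mem_powersetCard, sumUps, diffUps] using hg
  · rintro ⟨p, q⟩ hp
    simp only [Finset.mem_product, Finset.mem_powersetCard_univ] at hp
    rw [Finset.mem_filter, sumUps, diffUps]
    refine ⟨Finset.mem_univ _, ?_, ?_⟩
    · rw [← hp.1]
      congr 1
      ext i
      by_cases h₁ : i ∈ p <;> by_cases h₂ : i ∈ q <;> simp [h₁, h₂]
    · rw [← hp.2]
      congr 1
      ext i
      by_cases h₁ : i ∈ p <;> by_cases h₂ : i ∈ q <;> simp [h₁, h₂]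
  · intro g _
    funext i
    simp only [Finset.mem_filter, Finset.mem_univ, true_and]
    generalize g i = a
    fin_cases a <;> simp
  · rintro ⟨p, q⟩ _
    ext i <;> by_cases h₁ : i ∈ p <;> by_cases h₂ : i ∈ q <;> simp [h₁, h₂]

theorem finSigmaFinEquiv_lt_sum_iff {k : ℕ} (s : Fin k → ℕ) (x : (q : Fin k) × Fin (s q))
    (r : ℕ) :
    (finSigmaFinEquiv x : ℕ) < (∑ i : Fin k, if (i : ℕ) ≤ r then s i else 0) ↔ (x.1 : ℕ) ≤ r := by
  obtain ⟨q, a⟩ := x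
  have hval : (finSigmaFinEquiv ⟨q, a⟩ : ℕ) = (∑ i, if i < q then s i else 0) + a := by
    rw [finSigmaFinEquiv_apply, ← Finset.sum_filter]
    congr 1
    refine Finset.sum_bij (fun i _ => Fin.castLE q.2.le i) ?_ ?_ ?_ ?_
    · intro i _
      exact Finset.mem_filter.2 ⟨Finset.mem_univ _, Fin.lt_def.2 i.2⟩
    · intro i _ i' _ h
      simpa using h
    · intro i hi
      simp only [Finset.mem_filter, Finset.mem_univ, true_and] at hi
      exact ⟨⟨i, hi⟩, Finset.mem_univ _, rfl⟩
    · intro i _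
      rfl
  rw [hval]
  constructor
  · intro h
    by_contra! hr
    have : (∑ i : Fin k, if (i : ℕ) ≤ r then s i else 0) ≤ ∑ i, if i < q then s i else 0 := by
      refine Finset.sum_le_sum fun i _ => ?_
      by_cases hi : (i : ℕ) ≤ r
      · rw [if_pos hi, if_pos (Fin.lt_def.2 (hi.trans_lt hr))]
      · simp [hi]
    omega
  · intro h
    have hle : (∑ i, if i < q then s i else 0) + (∑ i, if i = q then s i else 0)
        ≤ ∑ i : Fin k, if (i : ℕ) ≤ r then s i else 0 := by
      rw [← Finset.sum_add_distrib]
      refine Finset.sum_le_sum fun i _ => ?_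
      rcases lt_trichotomy i q with hi | hi | hi
      · simp [hi, hi.ne, (Fin.lt_def.1 hi).le.trans h]
      · simp [hi, h]
      · simp [hi.not_gt, hi.ne']
    rw [Finset.sum_ite_eq' Finset.univ q s, if_pos (Finset.mem_univ q)] at hle
    have := a.2
    omega

/-- Cutting a step sequence of length `∑ q, s q` into consecutive blocks of lengths `s q`. -/
def blockEquiv {k : ℕ} (s : Fin k → ℕ) (α : Type*) :
    (Fin (∑ q, s q) → α) ≃ ((q : Fin k) → Fin (s q) → α) :=
  (Equiv.arrowCongr finSigmaFinEquiv.symm (Equiv.refl α)).trans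
    (Equiv.piCurry fun _ _ => α)

theorem blockEquiv_apply {k : ℕ} (s : Fin k → ℕ) (α : Type*) (ε : Fin (∑ q, s q) → α)
    (q : Fin k) (a : Fin (s q)) :
    blockEquiv s α ε q a = ε (finSigmaFinEquiv ⟨q, a⟩) := rfl

theorem pos_sum_blocks {k : ℕ} (s : Fin k → ℕ) (ε : Fin (∑ q, s q) → Fin 4) (r : ℕ) :
    pos ε (∑ i : Fin k, if (i : ℕ) ≤ r then s i else 0)
      = ∑ q : Fin k, if (q : ℕ) ≤ r then ∑ a, step (blockEquiv s (Fin 4) ε q a) else 0 := by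
  rw [pos, ← finSigmaFinEquiv.sum_comp, Fintype.sum_sigma]
  refine Finset.sum_congr rfl fun q _ => ?_
  simp only [finSigmaFinEquiv_lt_sum_iff, blockEquiv_apply]
  split_ifs <;> simp

theorem pos_length {k : ℕ} (s : Fin k → ℕ) (ε : Fin (∑ q, s q) → Fin 4) :
    pos ε (∑ q, s q) = ∑ q : Fin k, ∑ a, step (blockEquiv s (Fin 4) ε q a) := by
  have h := pos_sum_blocks s ε k
  simpa only [fun i : Fin k => i.2.le, if_true] using h

theorem partial_sums_eq_zero_iff {j : ℕ} (Y : Fin (j + 1) → ℤ) :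
    (∑ q, Y q = 0 ∧ ∀ r : Fin j, (∑ q : Fin (j + 1), if (q : ℕ) ≤ r then Y q else 0) = 0)
      ↔ ∀ q, Y q = 0 := by
  refine ⟨fun ⟨htot, hpart⟩ q => ?_, fun h => by simp [h]⟩
  have hle : ∀ r ≤ j, (∑ q : Fin (j + 1), if (q : ℕ) ≤ r then Y q else 0) = 0 := by
    intro r hr
    rcases hr.lt_or_eq with hr | rfl
    · exact hpart ⟨r, hr⟩
    · simpa only [fun i : Fin (r + 1) => Nat.lt_succ_iff.1 i.2, if_true] using htot
  have hlt : (∑ i : Fin (j + 1), if (i : ℕ) < q then Y i else 0) = 0 := by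
    rcases Nat.eq_zero_or_pos (q : ℕ) with h0 | h0
    · simp [h0]
    · simpa only [Nat.lt_iff_le_pred h0] using hle ((q : ℕ) - 1) (by omega)
  have hsub : (∑ i : Fin (j + 1), if (i : ℕ) ≤ q then Y i else 0)
      = (∑ i : Fin (j + 1), if (i : ℕ) < q then Y i else 0) + ∑ i, if i = q then Y i else 0 := by
    rw [← Finset.sum_add_distrib]
    refine Finset.sum_congr rfl fun i _ => ?_
    rcases lt_trichotomy i q with hi | hi | hi
    · simp [hi, hi.le, hi.ne]
    · simp [hi]
    · simp [hi.not_ge, hi.not_gt, hi.ne']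
  rw [hle q (by omega), hlt, Finset.sum_ite_eq' Finset.univ q Y,
    if_pos (Finset.mem_univ q)] at hsub
  omega

theorem pinned_iff {j N : ℕ} (s : Fin (j + 1) → ℕ) (hs : ∑ q, s q = 2 * N)
    (ε : Fin (∑ q, s q) → Fin 4) :
    (pos ε (∑ q, s q) = 0 ∧ ∀ r : Fin j,
        (pos ε (∑ i : Fin (j + 1), if (i : ℕ) ≤ (r : ℕ) then s i else 0)).2 = 0)
      ↔ (∀ q, sumUps (blockEquiv s (Fin 4) ε q) = diffUps (blockEquiv s (Fin 4) ε q)) ∧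
        ∑ q, sumUps (blockEquiv s (Fin 4) ε q) = N := by
  set f := blockEquiv s (Fin 4) ε
  have hY : (∀ q, (∑ a, step (f q a)).2 = 0) ↔ ∀ q, sumUps (f q) = diffUps (f q) := by
    refine forall_congr' fun q => ?_
    rw [sum_step_snd]
    omega
  have hX : (∀ q, sumUps (f q) = diffUps (f q)) →
      ((∑ q, (∑ a, step (f q a)).1 = 0) ↔ ∑ q, sumUps (f q) = N) := by
    intro h
    simp only [sum_step_fst, ← h]
    rw [Finset.sum_sub_distrib, Finset.sum_add_distrib]
    have hs' : (∑ q, (s q : ℤ)) = 2 * N := by exact_mod_cast hs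
    rw [hs', ← Nat.cast_sum]
    omega
  have hsnd : ∀ r : ℕ, (pos ε (∑ i : Fin (j + 1), if (i : ℕ) ≤ r then s i else 0)).2
      = ∑ q : Fin (j + 1), if (q : ℕ) ≤ r then (∑ a, step (f q a)).2 else 0 := by
    intro r
    rw [pos_sum_blocks, Prod.snd_sum]
    refine Finset.sum_congr rfl fun q _ => ?_
    split_ifs <;> rfl
  simp only [hsnd]
  rw [pos_length, Prod.ext_iff, Prod.fst_sum, Prod.snd_sum, Prod.fst_zero, Prod.snd_zero,
    and_assoc, partial_sums_eq_zero_iff, hY, and_comm]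
  exact and_congr_right hX

theorem card_pinned_eq_sum {j n N : ℕ} (s : Fin (j + 1) → ℕ) (hn : ∑ q, s q = n)
    (hN : n = 2 * N) :
    (Finset.univ.filter (fun ε : Fin n → Fin 4 =>
        pos ε n = 0 ∧ ∀ r : Fin j,
          (pos ε (∑ i : Fin (j + 1), if (i : ℕ) ≤ (r : ℕ) then s i else 0)).2 = 0)).card
      = ∑ l ∈ Finset.Nat.antidiagonalTuple (j + 1) N, ∏ r, ((s r).choose (l r)) ^ 2 := by
  subst hn
  simp only [pinned_iff s hN]
  have hcard : (Finset.univ.filter (fun ε : Fin (∑ q, s q) → Fin 4 =>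
      (∀ q, sumUps (blockEquiv s (Fin 4) ε q) = diffUps (blockEquiv s (Fin 4) ε q)) ∧
        ∑ q, sumUps (blockEquiv s (Fin 4) ε q) = N)).card
      = (Finset.univ.filter (fun f : (q : Fin (j + 1)) → Fin (s q) → Fin 4 =>
        (∀ q, sumUps (f q) = diffUps (f q)) ∧ ∑ q, sumUps (f q) = N)).card :=
    Finset.card_equiv (blockEquiv s (Fin 4)) (by simp)
  rw [hcard, Finset.card_eq_sum_card_fiberwise (f := fun f q => sumUps (f q))
    (t := Finset.Nat.antidiagonalTuple (j + 1) N)]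
  · refine Finset.sum_congr rfl fun l hl => ?_
    rw [Finset.Nat.mem_antidiagonalTuple] at hl
    simp only [← card_sumUps_eq_and_diffUps_eq]
    rw [← Fintype.card_piFinset]
    congr 1
    ext f
    simp only [Finset.mem_filter, Finset.mem_univ, true_and, Fintype.mem_piFinset]
    constructor
    · rintro ⟨⟨h, -⟩, rfl⟩ q
      exact ⟨rfl, (h q).symm⟩
    · intro h
      obtain rfl : (fun q => sumUps (f q)) = l := funext fun q => (h q).1
      exact ⟨⟨fun q => (h q).2.symm, hl⟩, rfl⟩
  · intro f hf
    simpa [Finset.Nat.mem_antidiagonalTuple] using (Finset.mem_filter.1 hf).2.2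

theorem sum_antidiagonalTuple_choose_sq {k M N : ℕ} (l : Fin k → ℕ) (hl : ∑ r, l r = M) :
    ∑ s ∈ Finset.Nat.antidiagonalTuple k (M + N), ∏ r, ((s r).choose (l r)) ^ 2
      = ∑ m ∈ Finset.Nat.antidiagonalTuple k N, ∏ r, ((l r + m r).choose (l r)) ^ 2 := by
  symm
  refine Finset.sum_of_injOn (fun m => l + m) ?_ ?_ ?_ ?_
  · intro m _ m' _ h
    exact add_left_cancel h
  · intro m hm
    simp only [Finset.mem_coe, Finset.Nat.mem_antidiagonalTuple] at hm ⊢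
    simp [Finset.sum_add_distrib, hl, hm]
  · intro s hs hnot
    have hex : ∃ r, s r < l r := by
      by_contra! hle
      refine hnot ⟨s - l, ?_, add_tsub_cancel_of_le hle⟩
      rw [Finset.Nat.mem_antidiagonalTuple] at hs
      have hsum : ∑ r, (s - l) r + ∑ r, l r = ∑ r, s r := by
        rw [← Finset.sum_add_distrib]
        exact Finset.sum_congr rfl fun r _ => Nat.sub_add_cancel (hle r)
      simp only [Finset.mem_coe, Finset.Nat.mem_antidiagonalTuple]
      omega
    obtain ⟨r, hr⟩ := hex
    exact Finset.prod_eq_zero (Finset.mem_univ r) (by simp [Nat.choose_eq_zero_of_lt hr])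
  · intro m _
    rfl

/-- Summing over all `(j+1)`-tuples `(s_0,…,s_j)` of nonnegative integers with
`s_0 + … + s_j = 2N` the number of paths of length `2N` on `ℤ²` from the origin to the
origin (with unit steps) whose second coordinate vanishes at each of the times
`t_r = s_0 + … + s_r`, `r = 0,…,j−1`, yields exactly `A(N,j)`. -/
theorem pinned_path_count_eq_A (N j : ℕ) (hN : 1 ≤ N) (hj : 1 ≤ j) :
    ∑ s ∈ Finset.Nat.antidiagonalTuple (j+1) (2*N),
      (Finset.univ.filter (fun ε : Fin (2*N) → Fin 4 =>
          pos ε (2*N) = 0 ∧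
          ∀ r : Fin j,
            (pos ε (∑ i : Fin (j+1), if (i : ℕ) ≤ (r : ℕ) then s i else 0)).2 = 0)).card
      = A N j := by
  have hcount : ∀ s ∈ Finset.Nat.antidiagonalTuple (j+1) (2*N), _ := fun s hs =>
    card_pinned_eq_sum (N := N) s (Finset.Nat.mem_antidiagonalTuple.1 hs) rfl
  rw [Finset.sum_congr rfl hcount, Finset.sum_comm, A]
  refine Finset.sum_congr rfl fun l hl => ?_
  rw [two_mul, sum_antidiagonalTuple_choose_sq l (Finset.Nat.mem_antidiagonalTuple.1 hl)]
end
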